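/- arXiv:2404.11175 — 7 statements merged into one kernel-verified Lean document; each statement's English description precedes it below -/
import Mathlib

section
/- (Theorem 1, lower-bound part.) For every unitary matrix U in the unitary group of Matrix ι ι ℂ, the von Neumann entropy of the partial trace over A of U ρ U* satisfies S(Tr_A (U ρ U*)) ≥ Σ_{k : Fin K} Σ_{b : Fin (dB k)} (− q k b · Real.log (q k b)). (Tr_A (U ρ U*) is Hermitian, so its entropy is well defined.) -/
open scoped Classical Matrix ComplexOrder

namespace AQD

/-- Von Neumann entropy of a (Hermitian) matrix: `∑ i, -λ_i log λ_i` where `λ` are the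
eigenvalues; defined to be `0` on non-Hermitian matrices. -/
noncomputable def vnEntropy {n : Type*} [Fintype n] [DecidableEq n] (M : Matrix n n ℂ) : ℝ :=
  if hM : M.IsHermitian then ∑ i, (- hM.eigenvalues i * Real.log (hM.eigenvalues i)) else 0

variable {K : ℕ}

/-- `offset k = ∑_{k' < k} dA k' * dB k'`. -/
def offset (dA dB : Fin K → ℕ) (k : Fin K) : ℕ :=
  ∑ k' ∈ Finset.Iio k, dA k' * dB k'

theorem idx_lt (dA dB : Fin K → ℕ) (k : Fin K) (b : Fin (dB k)) (a : Fin (dA k)) :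
    offset dA dB k + (b : ℕ) * dA k + (a : ℕ) < ∑ k', dA k' * dB k' := by
  have ha := a.isLt
  have hb := b.isLt
  have h1 : (b : ℕ) * dA k + (a : ℕ) < dA k * dB k := by
    have h2 : ((b : ℕ) + 1) * dA k ≤ dB k * dA k := Nat.mul_le_mul_right _ hb
    have h3 : (b : ℕ) * dA k + (a : ℕ) < ((b : ℕ) + 1) * dA k := by
      rw [Nat.add_mul, Nat.one_mul]; omega
    calc (b : ℕ) * dA k + (a : ℕ) < ((b : ℕ) + 1) * dA k := h3
      _ ≤ dB k * dA k := h2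
      _ = dA k * dB k := Nat.mul_comm _ _
  have hsub : Finset.Iio k ⊆ (Finset.univ : Finset (Fin K)) := Finset.subset_univ _
  have hsplit : ∑ k' ∈ (Finset.univ : Finset (Fin K)) \ Finset.Iio k, dA k' * dB k' +
      ∑ k' ∈ Finset.Iio k, dA k' * dB k' = ∑ k', dA k' * dB k' :=
    Finset.sum_sdiff hsub
  have hk : k ∈ (Finset.univ : Finset (Fin K)) \ Finset.Iio k := by simp
  have hle : dA k * dB k ≤ ∑ k' ∈ (Finset.univ : Finset (Fin K)) \ Finset.Iio k, dA k' * dB k' :=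
    Finset.single_le_sum (f := fun k' => dA k' * dB k') (fun i _ => Nat.zero_le _) hk
  unfold offset
  omega

/-- The index `offset k + b * dA k + a` as an element of `Fin (∑_k dA k * dB k)`. -/
def idx (dA dB : Fin K → ℕ) (k : Fin K) (b : Fin (dB k)) (a : Fin (dA k)) :
    Fin (∑ k', dA k' * dB k') :=
  ⟨offset dA dB k + (b : ℕ) * dA k + (a : ℕ), idx_lt dA dB k b a⟩

/-- Partial trace over subsystem `A`. -/
noncomputable def ptraceA (dA dB : Fin K → ℕ)
    (M : Matrix (Σ k : Fin K, Fin (dA k) × Fin (dB k)) (Σ k : Fin K, Fin (dA k) × Fin (dB k)) ℂ) :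
    Matrix (Σ k : Fin K, Fin (dB k)) (Σ k : Fin K, Fin (dB k)) ℂ :=
  fun x y =>
    if h : y.1 = x.1 then ∑ a : Fin (dA x.1), M ⟨x.1, (a, x.2)⟩ ⟨x.1, (a, h ▸ y.2)⟩ else 0

/-- `q k b = ∑_a p (offset k + b * dA k + a)`. -/
noncomputable def qval (dA dB : Fin K → ℕ) (p : Fin (∑ k', dA k' * dB k') → ℝ)
    (k : Fin K) (b : Fin (dB k)) : ℝ :=
  ∑ a : Fin (dA k), p (idx dA dB k b a)

/-- A weighted sum with weights in `[0, 1]` of total at most `L` of an antitone nonnegative sequence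
is at most the sum of its first `L` terms. -/
theorem sum_mul_le_sum_range {P : ℕ → ℝ} (hP : Antitone P) (hP0 : ∀ i, 0 ≤ P i) {N : ℕ} (L : ℕ)
    {w : Fin N → ℝ} (hw0 : ∀ i, 0 ≤ w i) (hw1 : ∀ i, w i ≤ 1) (hw : ∑ i, w i ≤ L) :
    ∑ i : Fin N, P i * w i ≤ ∑ i ∈ Finset.range L, P i := by
  have h1 : ∑ i : Fin N, (P i - P L) * w i ≤
      ∑ i : Fin N, if (i : ℕ) < L then P i - P L else 0 := by
    refine Finset.sum_le_sum fun i _ => ?_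
    split_ifs with h
    · exact mul_le_of_le_one_right (sub_nonneg.2 (hP h.le)) (hw1 i)
    · exact mul_nonpos_of_nonpos_of_nonneg (sub_nonpos.2 (hP (not_lt.1 h))) (hw0 i)
  have h2 : (∑ i : Fin N, if (i : ℕ) < L then P i - P L else 0) ≤
      ∑ i ∈ Finset.range L, (P i - P L) := by
    rw [Fin.sum_univ_eq_sum_range (fun i => if i < L then P i - P L else 0) N,
      ← Finset.sum_filter]
    refine Finset.sum_le_sum_of_subset_of_nonneg (fun i hi => by simp_all) fun i hi _ => ?_
    exact sub_nonneg.2 (hP (Finset.mem_range.1 hi).le)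
  have h3 := mul_le_mul_of_nonneg_left hw (hP0 L)
  simp only [sub_mul, Finset.sum_sub_distrib, ← Finset.mul_sum, Finset.sum_const,
    Finset.card_range, nsmul_eq_mul] at h1 h2
  linarith

theorem sum_range_sum_range {P : ℕ → ℝ} (d : ℕ → ℕ) (n : ℕ) :
    ∑ j ∈ Finset.range n, ∑ a ∈ Finset.range (d j), P (∑ i ∈ Finset.range j, d i + a) =
      ∑ i ∈ Finset.range (∑ i ∈ Finset.range n, d i), P i := by
  induction n with
  | zero => simp
  | succ n ih => rw [Finset.sum_range_succ, Finset.sum_range_succ, Finset.sum_range_add, ih]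

/-- The tangent line bound for the concave function `Real.negMulLog`. -/
theorem negMulLog_sub_le {x y : ℝ} (hx : 0 < x) (hy : 0 ≤ y) :
    Real.negMulLog y - Real.negMulLog x ≤ (y - x) * (-Real.log x - 1) := by
  rcases hy.eq_or_lt with rfl | hy
  · simp only [Real.negMulLog]; nlinarith
  · have h := Real.log_le_sub_one_of_pos (div_pos hx hy)
    rw [Real.log_div hx.ne' hy.ne'] at h
    have h' := mul_le_mul_of_nonneg_left h hy.le
    have h2 : y * (x / y - 1) = x - y := by field_simp
    simp only [Real.negMulLog]
    nlinarith

theorem sum_negMulLog_sub_le {x y : ℕ → ℝ} (hx : Antitone x) (hy : ∀ i, 0 ≤ y i) (n : ℕ)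
    (hxy : ∀ k ≤ n, ∑ i ∈ Finset.range k, x i ≤ ∑ i ∈ Finset.range k, y i)
    {c : ℝ} (hc : 0 < c) (hcx : ∀ i < n, c ≤ x i) :
    ∑ i ∈ Finset.range n, (Real.negMulLog (y i) - Real.negMulLog (x i)) ≤
      (∑ i ∈ Finset.range n, y i - ∑ i ∈ Finset.range n, x i) * (-Real.log c - 1) := by
  induction n generalizing c with
  | zero => simp
  | succ n ih =>
    have hcn := hcx n n.lt_succ_self
    have hxn : 0 < x n := hc.trans_le hcn
    have h1 := ih (fun k hk => hxy k (by omega)) hxn (fun i hi => hx hi.le)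
    have h2 := negMulLog_sub_le hxn (hy n)
    have h3 : -Real.log (x n) - 1 ≤ -Real.log c - 1 := by
      linarith [Real.log_le_log hc hcn]
    have h4 := mul_le_mul_of_nonneg_left h3 (sub_nonneg.2 (hxy (n + 1) le_rfl))
    simp only [Finset.sum_range_succ] at h4 ⊢
    linarith

/-- Karamata's inequality for `Real.negMulLog`. -/
theorem sum_negMulLog_le_of_majorized {x y : ℕ → ℝ} (hx : Antitone x) (hx0 : ∀ i, 0 ≤ x i)
    (hy : ∀ i, 0 ≤ y i) (n : ℕ)
    (hxy : ∀ k ≤ n, ∑ i ∈ Finset.range k, x i ≤ ∑ i ∈ Finset.range k, y i)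
    (heq : ∑ i ∈ Finset.range n, x i = ∑ i ∈ Finset.range n, y i) :
    ∑ i ∈ Finset.range n, Real.negMulLog (y i) ≤ ∑ i ∈ Finset.range n, Real.negMulLog (x i) := by
  induction n with
  | zero => simp
  | succ n ih =>
    rcases (hx0 n).eq_or_lt with h0 | h0
    · have h1 := hxy n n.le_succ
      rw [Finset.sum_range_succ, Finset.sum_range_succ, ← h0] at heq
      have hyn : y n = 0 := by linarith [hy n]
      rw [Finset.sum_range_succ, Finset.sum_range_succ, ← h0, hyn]
      linarith [ih (fun k hk => hxy k (by omega)) (by linarith)]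
    · have h := sum_negMulLog_sub_le hx hy (n + 1) hxy h0 fun i hi => hx (Nat.le_of_lt_succ hi)
      rw [heq, sub_self, zero_mul, Finset.sum_sub_distrib] at h
      linarith

/-- Extension of a function on `Fin m` to `ℕ` by zero. -/
def extendZero {α : Type*} [Zero α] {m : ℕ} (f : Fin m → α) (i : ℕ) : α :=
  if h : i < m then f ⟨i, h⟩ else 0

theorem extendZero_val {α : Type*} [Zero α] {m : ℕ} (f : Fin m → α) (i : Fin m) :
    extendZero f i = f i := by
  simp [extendZero]

theorem extendZero_nonneg {α : Type*} [Zero α] [Preorder α] {m : ℕ} {f : Fin m → α}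
    (hf : ∀ i, 0 ≤ f i) (i : ℕ) : 0 ≤ extendZero f i := by
  unfold extendZero
  split_ifs
  exacts [hf _, le_rfl]

theorem extendZero_antitone {α : Type*} [Zero α] [Preorder α] {m : ℕ} {f : Fin m → α}
    (hf : Antitone f) (hf0 : ∀ i, 0 ≤ f i) : Antitone (extendZero f) := by
  intro i j hij
  by_cases hj : j < m
  · simpa [extendZero, hj, hij.trans_lt hj] using hf (Fin.mk_le_mk.2 hij)
  · simpa [extendZero, hj] using extendZero_nonneg hf0 i

theorem sum_range_extendZero {α : Type*} [AddCommMonoid α] {m : ℕ} (f : Fin m → α) {n : ℕ}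
    (hn : n ≤ m) :
    ∑ i ∈ Finset.range n, extendZero f i = ∑ i : Fin m, if (i : ℕ) < n then f i else 0 := by
  have h : ∀ i : Fin m, (if (i : ℕ) < n then f i else 0) =
      (fun j => if j < n then extendZero f j else 0) i := fun i => by
    simp only [extendZero_val]
  rw [Finset.sum_congr rfl fun i _ => h i,
    Fin.sum_univ_eq_sum_range (fun j => if j < n then extendZero f j else 0), ← Finset.sum_filter]
  refine Finset.sum_congr ?_ fun _ _ => rfl
  ext i
  simp only [Finset.mem_range, Finset.mem_filter]
  omega

theorem sum_range_extendZero_self {α : Type*} [AddCommMonoid α] {m : ℕ} (f : Fin m → α) :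
    ∑ i ∈ Finset.range m, extendZero f i = ∑ i, f i := by
  simp [sum_range_extendZero f le_rfl]

/-- If the weights `W` have marginals controlled by a doubly stochastic matrix `T`, a sum of `n` of
the averages of `D` is at most the sum of `D` over its first `n` blocks of lengths `d`. -/
theorem sum_weighted_averages_le {m N : ℕ} {D : Fin N → ℝ} (hD : Antitone D) (hD0 : ∀ i, 0 ≤ D i)
    {d : Fin m → ℕ} (hd : Antitone d) {W : Fin N → Fin m → ℝ} {T : Fin m → Fin m → ℝ}
    (hW0 : ∀ i j, 0 ≤ W i j) (hT0 : ∀ x j, 0 ≤ T x j) (hW : ∀ i, ∑ j, W i j = 1)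
    (hTr : ∀ x, ∑ j, T x j = 1) (hTc : ∀ j, ∑ x, T x j = 1)
    (hWT : ∀ j, ∑ i, W i j = ∑ x, (d x : ℝ) * T x j) (s : Finset (Fin m)) :
    ∑ j ∈ s, ∑ i, D i * W i j ≤
      ∑ i ∈ Finset.range (∑ j ∈ Finset.range s.card, extendZero d j), extendZero D i := by
  have hsub : ∀ f : Fin m → ℝ, (∀ j, 0 ≤ f j) → ∑ j, f j = 1 → ∑ j ∈ s, f j ≤ 1 :=
    fun f hf h1 => h1 ▸ Finset.sum_le_univ_sum_of_nonneg hf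
  have hdc : ∀ i, (extendZero (fun x => (d x : ℝ)) i) = (extendZero d i : ℕ) := fun i => by
    unfold extendZero
    split_ifs <;> simp
  have hT : ∑ x : Fin m, extendZero (fun x => (d x : ℝ)) x * ∑ j ∈ s, T x j ≤
      ∑ i ∈ Finset.range s.card, extendZero (fun x => (d x : ℝ)) i := by
    refine sum_mul_le_sum_range (extendZero_antitone (fun x y h => Nat.cast_le.2 (hd h))
      fun x => Nat.cast_nonneg _) (extendZero_nonneg fun x => Nat.cast_nonneg _) _
      (fun x => Finset.sum_nonneg fun j _ => hT0 x j) (fun x => hsub _ (hT0 x) (hTr x)) ?_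
    rw [Finset.sum_comm]
    simp [hTc]
  have hkey := sum_mul_le_sum_range (extendZero_antitone hD hD0) (extendZero_nonneg hD0)
    (∑ j ∈ Finset.range s.card, extendZero d j) (w := fun i => ∑ j ∈ s, W i j)
    (fun i => Finset.sum_nonneg fun j _ => hW0 i j) (fun i => hsub _ (hW0 i) (hW i)) (by
      rw [Finset.sum_comm, Finset.sum_congr rfl fun j _ => hWT j, Finset.sum_comm]
      simp_rw [extendZero_val, Finset.mul_sum] at hT
      rw [Nat.cast_sum]
      simpa only [hdc] using hT)
  refine le_trans (le_of_eq ?_) hkey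
  rw [Finset.sum_comm]
  simp_rw [extendZero_val, Finset.mul_sum]

/-- Among all averages of an antitone sequence `D` with weights `W` as in
`sum_weighted_averages_le`, the sums of `D` over consecutive blocks have the least entropy. -/
theorem sum_negMulLog_blocks_le {m N : ℕ} {D : Fin N → ℝ} (hD : Antitone D) (hD0 : ∀ i, 0 ≤ D i)
    {d : Fin m → ℕ} (hd : Antitone d) (hdN : ∑ j, d j = N)
    {W : Fin N → Fin m → ℝ} {T : Fin m → Fin m → ℝ}
    (hW0 : ∀ i j, 0 ≤ W i j) (hT0 : ∀ x j, 0 ≤ T x j) (hW : ∀ i, ∑ j, W i j = 1)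
    (hTr : ∀ x, ∑ j, T x j = 1) (hTc : ∀ j, ∑ x, T x j = 1)
    (hWT : ∀ j, ∑ i, W i j = ∑ x, (d x : ℝ) * T x j) :
    ∑ j : Fin m, Real.negMulLog (∑ a ∈ Finset.range (d j),
        extendZero D (∑ i ∈ Finset.range j, extendZero d i + a)) ≤
      ∑ j, Real.negMulLog (∑ i, D i * W i j) := by
  set x : Fin m → ℝ := fun j => ∑ i, D i * W i j with hx
  have hx0 : ∀ j, 0 ≤ x j := fun j => Finset.sum_nonneg fun i _ => mul_nonneg (hD0 i) (hW0 i j)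
  set σ : Equiv.Perm (Fin m) := Tuple.sort (fun j => -x j)
  have hσ : Antitone (x ∘ σ) := fun i j h =>
    neg_le_neg_iff.1 (Tuple.monotone_sort (fun j => -x j) h)
  set y : ℕ → ℝ := fun j => ∑ a ∈ Finset.range (extendZero d j),
    extendZero D (∑ i ∈ Finset.range j, extendZero d i + a) with hy
  have hmain := sum_negMulLog_le_of_majorized (extendZero_antitone hσ fun j => hx0 _)
    (extendZero_nonneg fun j => hx0 _) (y := y)
    (fun j => Finset.sum_nonneg fun a _ => extendZero_nonneg hD0 _) m (fun k hk => by
      rw [hy, sum_range_sum_range, sum_range_extendZero _ hk, ← Finset.sum_filter]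
      have h := sum_weighted_averages_le hD hD0 hd hW0 hT0 hW hTr hTc hWT
        ((Finset.univ.filter fun i : Fin m => (i : ℕ) < k).map σ.toEmbedding)
      rw [Finset.sum_map, Finset.card_map, Fin.card_filter_val_lt, min_eq_right hk] at h
      exact h) (by
      rw [hy, sum_range_sum_range, sum_range_extendZero_self, sum_range_extendZero_self, hdN,
        sum_range_extendZero_self]
      simp only [Function.comp_def]
      rw [Equiv.sum_comp σ x, hx, Finset.sum_comm]
      simp_rw [← Finset.mul_sum, hW, mul_one])
  rw [← Fin.sum_univ_eq_sum_range (fun j => Real.negMulLog (y j)),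
    ← Fin.sum_univ_eq_sum_range (fun j => Real.negMulLog (extendZero (x ∘ σ) j))] at hmain
  simp only [hy, extendZero_val, Function.comp_def] at hmain
  rwa [Equiv.sum_comp σ fun j => Real.negMulLog (x j)] at hmain

/-- The increasing enumeration of `Σ k, Fin (dB k)` in the lexicographic order. -/
theorem exists_lex_enumeration (dA dB : Fin K → ℕ) :
    ∃ τ : Fin (Fintype.card (Σ k : Fin K, Fin (dB k))) ≃ (Σ k : Fin K, Fin (dB k)),
      (Monotone fun j => (τ j).1) ∧
      ∀ j : Fin _, ∑ i ∈ Finset.range j, extendZero (fun i => dA (τ i).1) i =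
        offset dA dB (τ j).1 + ((τ j).2 : ℕ) * dA (τ j).1 := by
  let α := _root_.Lex (Σ k : Fin K, Fin (dB k))
  let τ : Fin (Fintype.card (Σ k : Fin K, Fin (dB k))) ≃o α :=
    monoEquivOfFin α (Fintype.card_congr ofLex)
  refine ⟨τ.toEquiv.trans ofLex, fun i j hij => ?_, fun j => ?_⟩
  · rcases Sigma.Lex.le_def.1 (τ.monotone hij) with h | ⟨h, -⟩
    exacts [h.le, h.le]
  · rw [sum_range_extendZero _ j.2.le]
    obtain ⟨⟨k, b⟩, hkb⟩ : ∃ x, ofLex (τ j) = x := ⟨_, rfl⟩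
    have hlt : ∀ i : Fin _, (i : ℕ) < j ↔ toLex (ofLex (τ i)) < toLex (⟨k, b⟩ : Σ k, Fin (dB k)) := by
      intro i
      rw [← hkb, toLex_ofLex, toLex_ofLex, τ.lt_iff_lt, Fin.lt_def]
    simp only [hlt, Equiv.trans_apply, RelIso.coe_fn_toEquiv]
    rw [hkb]
    refine (Equiv.sum_comp (τ.toEquiv.trans ofLex) (fun x =>
      if toLex x < toLex (⟨k, b⟩ : Σ k, Fin (dB k)) then dA x.1 else 0)).trans ?_
    rw [Fintype.sum_sigma]
    have hlex : ∀ (k' : Fin K) (b' : Fin (dB k')),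
        toLex (⟨k', b'⟩ : Σ k, Fin (dB k)) < toLex (⟨k, b⟩ : Σ k, Fin (dB k)) ↔
          k' < k ∨ ∃ h : k' = k, h ▸ b' < b := fun _ _ => Sigma.Lex.lt_def
    have h1 : ∀ k' : Fin K, (∑ b' : Fin (dB k'),
        if toLex (⟨k', b'⟩ : Σ k, Fin (dB k)) < toLex (⟨k, b⟩ : Σ k, Fin (dB k))
          then dA k' else 0) =
        (if k' < k then dA k' * dB k' else 0) + if k' = k then (b : ℕ) * dA k else 0 := by
      intro k'
      rcases lt_trichotomy k' k with h | rfl | h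
      · simp [hlex, h, h.ne, mul_comm]
      · simp [hlex, ← Finset.sum_filter, Finset.filter_gt_eq_Iio]
      · simp [hlex, h.not_gt, h.ne']
    simp only [h1]
    rw [Finset.sum_add_distrib, ← Finset.sum_filter]
    simp [offset, Finset.filter_gt_eq_Iio]

theorem mul_diagonal_mul_conjTranspose_apply_self {m n : Type*} [Fintype n] [DecidableEq n]
    (A : Matrix m n ℂ) (D : n → ℝ) (j : m) :
    (A * Matrix.diagonal (fun i => (D i : ℂ)) * Aᴴ) j j =
      ((∑ i, D i * Complex.normSq (A j i) : ℝ) : ℂ) := by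
  rw [Matrix.mul_apply]
  push_cast
  refine Finset.sum_congr rfl fun i _ => ?_
  rw [Matrix.mul_diagonal, Matrix.conjTranspose_apply, Complex.normSq_eq_conj_mul_self]
  simp only [RCLike.star_def]
  ring

theorem sum_normSq_row {m n : Type*} [Fintype n] (A : Matrix m n ℂ) (j : m) :
    ((∑ i, Complex.normSq (A j i) : ℝ) : ℂ) = (A * Aᴴ) j j := by
  simpa using (mul_diagonal_mul_conjTranspose_apply_self A (fun _ => 1) j).symm

theorem sum_normSq_col {m n : Type*} [Fintype m] (A : Matrix m n ℂ) (i : n) :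
    ((∑ j, Complex.normSq (A j i) : ℝ) : ℂ) = (Aᴴ * A) i i := by
  simpa using sum_normSq_row Aᴴ i

theorem sum_normSq_unitary_row {n : Type*} [Fintype n] [DecidableEq n]
    (V : Matrix.unitaryGroup n ℂ) (x : n) :
    ∑ j, Complex.normSq ((V : Matrix n n ℂ) x j) = 1 := by
  have h := sum_normSq_row (V : Matrix n n ℂ) x
  rw [← Matrix.star_eq_conjTranspose, Unitary.mul_star_self_of_mem V.2, Matrix.one_apply_eq] at h
  exact_mod_cast h

theorem sum_normSq_unitary_col {n : Type*} [Fintype n] [DecidableEq n]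
    (V : Matrix.unitaryGroup n ℂ) (j : n) :
    ∑ x, Complex.normSq ((V : Matrix n n ℂ) x j) = 1 := by
  have h := sum_normSq_col (V : Matrix n n ℂ) j
  rw [← Matrix.star_eq_conjTranspose, Unitary.star_mul_self_of_mem V.2, Matrix.one_apply_eq] at h
  exact_mod_cast h

/-- If `R = ∑ z, J z * M * (J z)ᴴ` with `∑ z, (J z)ᴴ * J z = 1` and `∑ z, J z * (J z)ᴴ` diagonal,
the eigenvalues of `R` are averages of the eigenvalues of `M`, with weights whose marginals are
controlled by the squared moduli of the entries of a unitary matrix. -/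
theorem exists_weights_of_kraus {κ β ι : Type*} [Fintype κ] [Fintype β] [Fintype ι]
    [DecidableEq β] [DecidableEq ι]
    (J : κ → Matrix β ι ℂ) (d : β → ℝ)
    (hJ : ∑ z, (J z)ᴴ * J z = 1)
    (hd : ∑ z, J z * (J z)ᴴ = Matrix.diagonal (fun x => (d x : ℂ)))
    (X : Matrix.unitaryGroup ι ℂ) (D : ι → ℝ) {R : Matrix β β ℂ} (hR : R.IsHermitian)
    (hRJ : R = ∑ z, J z * ((X : Matrix ι ι ℂ) * Matrix.diagonal (fun i => (D i : ℂ)) *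
      (X : Matrix ι ι ℂ)ᴴ) * (J z)ᴴ) :
    ∃ (W : ι → β → ℝ) (T : β → β → ℝ), (∀ i j, 0 ≤ W i j) ∧ (∀ x j, 0 ≤ T x j) ∧
      (∀ i, ∑ j, W i j = 1) ∧ (∀ x, ∑ j, T x j = 1) ∧ (∀ j, ∑ x, T x j = 1) ∧
      (∀ j, ∑ i, W i j = ∑ x, d x * T x j) ∧ ∀ j, hR.eigenvalues j = ∑ i, D i * W i j := by
  set V := hR.eigenvectorUnitary
  have hVV : (V : Matrix β β ℂ) * (V : Matrix β β ℂ)ᴴ = 1 := Unitary.mul_star_self_of_mem V.2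
  have hXX : (X : Matrix ι ι ℂ) * (X : Matrix ι ι ℂ)ᴴ = 1 := Unitary.mul_star_self_of_mem X.2
  have hXX' : (X : Matrix ι ι ℂ)ᴴ * (X : Matrix ι ι ℂ) = 1 := Unitary.star_mul_self_of_mem X.2
  have hdiag : (V : Matrix β β ℂ)ᴴ * R * V =
      Matrix.diagonal (fun j => (hR.eigenvalues j : ℂ)) := by
    have := hR.conjStarAlgAut_star_eigenvectorUnitary
    rw [Unitary.conjStarAlgAut_star_apply] at this
    exact this
  set Y : κ → Matrix β ι ℂ := fun z => (V : Matrix β β ℂ)ᴴ * J z * (X : Matrix ι ι ℂ) with hY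
  refine ⟨fun i j => ∑ z, Complex.normSq (Y z j i),
    fun x j => Complex.normSq ((V : Matrix β β ℂ) x j),
    fun i j => Finset.sum_nonneg fun z _ => Complex.normSq_nonneg _,
    fun x j => Complex.normSq_nonneg _, fun i => ?_, sum_normSq_unitary_row V,
    sum_normSq_unitary_col V, fun j => ?_, fun j => ?_⟩
  · rw [Finset.sum_comm]
    apply Complex.ofReal_injective
    rw [Complex.ofReal_sum]
    simp_rw [sum_normSq_col]
    rw [← Matrix.sum_apply]
    have : ∑ z, (Y z)ᴴ * Y z = 1 := by
      calc ∑ z, (Y z)ᴴ * Y z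
          = ∑ z, (X : Matrix ι ι ℂ)ᴴ * ((J z)ᴴ * ((V : Matrix β β ℂ) * (V : Matrix β β ℂ)ᴴ) * J z) *
              (X : Matrix ι ι ℂ) := by
            simp only [hY, Matrix.conjTranspose_mul, Matrix.conjTranspose_conjTranspose,
              Matrix.mul_assoc]
        _ = 1 := by
            simp only [hVV, Matrix.mul_one]
            rw [← Matrix.sum_mul, ← Matrix.mul_sum, hJ, Matrix.mul_one, hXX']
    rw [this, Matrix.one_apply_eq, Complex.ofReal_one]
  · rw [Finset.sum_comm]
    apply Complex.ofReal_injective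
    rw [Complex.ofReal_sum]
    simp_rw [sum_normSq_row]
    rw [← Matrix.sum_apply]
    have : ∑ z, Y z * (Y z)ᴴ =
        (V : Matrix β β ℂ)ᴴ * Matrix.diagonal (fun x => (d x : ℂ)) * (V : Matrix β β ℂ)ᴴᴴ := by
      calc ∑ z, Y z * (Y z)ᴴ
          = ∑ z, (V : Matrix β β ℂ)ᴴ * (J z * ((X : Matrix ι ι ℂ) * (X : Matrix ι ι ℂ)ᴴ) * (J z)ᴴ) *
              (V : Matrix β β ℂ) := by
            simp only [hY, Matrix.conjTranspose_mul, Matrix.conjTranspose_conjTranspose,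
              Matrix.mul_assoc]
        _ = _ := by
            simp only [hXX, Matrix.mul_one]
            rw [← Matrix.sum_mul, ← Matrix.mul_sum, hd, Matrix.conjTranspose_conjTranspose]
    rw [this, mul_diagonal_mul_conjTranspose_apply_self]
    simp [Matrix.conjTranspose_apply]
  · apply Complex.ofReal_injective
    have h1 : (hR.eigenvalues j : ℂ) = ((V : Matrix β β ℂ)ᴴ * R * V) j j := by
      rw [hdiag, Matrix.diagonal_apply_eq]
    have h2 : (V : Matrix β β ℂ)ᴴ * R * V =
        ∑ z, Y z * Matrix.diagonal (fun i => (D i : ℂ)) * (Y z)ᴴ := by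
      rw [hRJ, Matrix.mul_sum, Matrix.sum_mul]
      simp only [hY, Matrix.conjTranspose_mul, Matrix.conjTranspose_conjTranspose,
        Matrix.mul_assoc]
    rw [h1, h2, Matrix.sum_apply]
    simp_rw [mul_diagonal_mul_conjTranspose_apply_self, Finset.mul_sum]
    rw [Finset.sum_comm, Complex.ofReal_sum]
/-- The index pair in `A` and `B` of an index of the direct sum. -/
def splitIndex (dA dB : Fin K → ℕ) (y : Σ k : Fin K, Fin (dA k) × Fin (dB k)) :
    (Σ k : Fin K, Fin (dA k)) × (Σ k : Fin K, Fin (dB k)) :=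
  (⟨y.1, y.2.1⟩, ⟨y.1, y.2.2⟩)

theorem splitIndex_injective (dA dB : Fin K → ℕ) : Function.Injective (splitIndex dA dB) := by
  rintro ⟨k, a, b⟩ ⟨k', a', b'⟩ h
  simp only [splitIndex, Prod.mk.injEq, Sigma.mk.injEq] at h
  obtain ⟨⟨rfl, h1⟩, -, h2⟩ := h
  simp_all

/-- The Kraus operators of the partial trace over `A`. -/
def ptraceKraus (dA dB : Fin K → ℕ) (z : Σ k : Fin K, Fin (dA k)) :
    Matrix (Σ k : Fin K, Fin (dB k)) (Σ k : Fin K, Fin (dA k) × Fin (dB k)) ℂ :=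
  fun x y => if splitIndex dA dB y = (z, x) then 1 else 0

theorem sum_ptraceKraus_mul (dA dB : Fin K → ℕ) (k l : Fin K) (a : Fin (dA k)) (b : Fin (dB l))
    (f : (Σ k : Fin K, Fin (dA k) × Fin (dB k)) → ℂ) :
    ∑ y, ptraceKraus dA dB ⟨k, a⟩ ⟨l, b⟩ y * f y =
      if h : l = k then f ⟨k, (a, h ▸ b)⟩ else 0 := by
  split_ifs with h
  · subst h
    rw [Finset.sum_eq_single ⟨l, (a, b)⟩]
    · simp [ptraceKraus, splitIndex]
    · intro y _ hy
      have : splitIndex dA dB y ≠ (⟨l, a⟩, ⟨l, b⟩) := fun h =>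
        hy (splitIndex_injective dA dB h)
      simp [ptraceKraus, this]
    · simp
  · refine Finset.sum_eq_zero fun y _ => ?_
    have : splitIndex dA dB y ≠ (⟨k, a⟩, ⟨l, b⟩) := by
      intro hy
      simp only [splitIndex, Prod.mk.injEq, Sigma.mk.injEq] at hy
      exact h (hy.2.1.symm.trans hy.1.1)
    simp [ptraceKraus, this]

theorem star_ptraceKraus_apply (dA dB : Fin K → ℕ) (z : Σ k : Fin K, Fin (dA k))
    (x : Σ k : Fin K, Fin (dB k)) (y : Σ k : Fin K, Fin (dA k) × Fin (dB k)) :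
    star (ptraceKraus dA dB z x y) = ptraceKraus dA dB z x y := by
  unfold ptraceKraus
  split_ifs <;> simp

theorem ptraceA_eq_sum_ptraceKraus (dA dB : Fin K → ℕ)
    (M : Matrix (Σ k : Fin K, Fin (dA k) × Fin (dB k)) (Σ k : Fin K, Fin (dA k) × Fin (dB k)) ℂ) :
    ptraceA dA dB M = ∑ z, ptraceKraus dA dB z * M * (ptraceKraus dA dB z)ᴴ := by
  ext ⟨l, b⟩ ⟨l', b'⟩
  rw [Matrix.sum_apply, Fintype.sum_sigma]
  have h1 : ∀ (k : Fin K) (a : Fin (dA k)),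
      (ptraceKraus dA dB ⟨k, a⟩ * M * (ptraceKraus dA dB ⟨k, a⟩)ᴴ) ⟨l, b⟩ ⟨l', b'⟩ =
      if h' : l' = k then (if h : l = k then M ⟨k, (a, h ▸ b)⟩ ⟨k, (a, h' ▸ b')⟩ else 0)
        else 0 := by
    intro k a
    simp_rw [Matrix.mul_apply, Matrix.conjTranspose_apply, star_ptraceKraus_apply,
      sum_ptraceKraus_mul]
    simp_rw [mul_comm _ (ptraceKraus dA dB ⟨k, a⟩ ⟨l', b'⟩ _), sum_ptraceKraus_mul]
  simp_rw [h1]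
  rw [Finset.sum_eq_single l]
  · by_cases h : l' = l
    · subst h
      simp [ptraceA]
    · simp [ptraceA, h]
  · intro k _ hk
    simp [hk.symm]
  · simp

theorem sum_conjTranspose_ptraceKraus_mul (dA dB : Fin K → ℕ) :
    ∑ z, (ptraceKraus dA dB z)ᴴ * ptraceKraus dA dB z = 1 := by
  ext y y'
  simp_rw [Matrix.sum_apply, Matrix.mul_apply, Matrix.conjTranspose_apply,
    star_ptraceKraus_apply, ← Fintype.sum_prod_type', ptraceKraus]
  simp [Matrix.one_apply, (splitIndex_injective dA dB).eq_iff, eq_comm]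

theorem sum_ptraceKraus_mul_conjTranspose (dA dB : Fin K → ℕ) :
    ∑ z, ptraceKraus dA dB z * (ptraceKraus dA dB z)ᴴ =
      Matrix.diagonal (fun x => (((dA x.1 : ℕ) : ℝ) : ℂ)) := by
  have h := ptraceA_eq_sum_ptraceKraus dA dB 1
  simp only [Matrix.mul_one] at h
  rw [← h]
  ext ⟨l, b⟩ ⟨l', b'⟩
  by_cases hl : l' = l
  · subst hl
    simp [ptraceA, Matrix.diagonal_apply, Matrix.one_apply]
  · have : l ≠ l' := Ne.symm hl
    simp [ptraceA, hl, this]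

/-- **Theorem 1 (lower-bound part).** For every unitary `U`, the von Neumann entropy of the
partial trace over `A` of `U ρ U*` is at least `∑_k ∑_b (- q k b * log (q k b))`. -/
theorem entropy_lower_bound
    (dA dB : Fin K → ℕ) (hA : ∀ k, 1 ≤ dA k) (hB : ∀ k, 1 ≤ dB k) (hAnti : Antitone dA)
    (ρ : Matrix (Σ k : Fin K, Fin (dA k) × Fin (dB k)) (Σ k : Fin K, Fin (dA k) × Fin (dB k)) ℂ)
    (hρ : ρ.IsHermitian) (hpos : ρ.PosSemidef) (htr : Matrix.trace ρ = 1)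
    (p : Fin (∑ k', dA k' * dB k') → ℝ) (hp : Antitone p)
    (e : Fin (∑ k', dA k' * dB k') ≃ (Σ k : Fin K, Fin (dA k) × Fin (dB k)))
    (hpe : ∀ i, p i = hρ.eigenvalues (e i))
    (U : Matrix.unitaryGroup (Σ k : Fin K, Fin (dA k) × Fin (dB k)) ℂ) :
    vnEntropy (ptraceA dA dB ((U : Matrix _ _ ℂ) * ρ * (U : Matrix _ _ ℂ)ᴴ)) ≥
      ∑ k : Fin K, ∑ b : Fin (dB k),
        (- qval dA dB p k b * Real.log (qval dA dB p k b)) := by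
  set X := U * hρ.eigenvectorUnitary with hX
  have hdec : (U : Matrix _ _ ℂ) * ρ * (U : Matrix _ _ ℂ)ᴴ = (X : Matrix _ _ ℂ) *
      Matrix.diagonal (fun i => (hρ.eigenvalues i : ℂ)) * (X : Matrix _ _ ℂ)ᴴ := by
    conv_lhs => rw [hρ.spectral_theorem, Unitary.conjStarAlgAut_apply]
    rw [hX, Matrix.UnitaryGroup.mul_val, Matrix.conjTranspose_mul]
    simp only [Matrix.mul_assoc]
    rfl
  set R := ptraceA dA dB ((U : Matrix _ _ ℂ) * ρ * (U : Matrix _ _ ℂ)ᴴ) with hRdef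
  have hRJ : R = ∑ z, ptraceKraus dA dB z * ((X : Matrix _ _ ℂ) *
      Matrix.diagonal (fun i => (hρ.eigenvalues i : ℂ)) * (X : Matrix _ _ ℂ)ᴴ) *
        (ptraceKraus dA dB z)ᴴ := by
    rw [hRdef, ptraceA_eq_sum_ptraceKraus, hdec]
  have hR : R.IsHermitian := by
    rw [hRJ]
    refine isSelfAdjoint_sum _ fun z _ => ?_
    rw [← hdec]
    exact Matrix.isHermitian_mul_mul_conjTranspose _
      (Matrix.isHermitian_mul_mul_conjTranspose _ hρ)
  obtain ⟨W, T, hW0, hT0, hW, hTr, hTc, hWT, hev⟩ := exists_weights_of_kraus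
    (ptraceKraus dA dB) (fun x => (dA x.1 : ℝ)) (sum_conjTranspose_ptraceKraus_mul dA dB)
    (sum_ptraceKraus_mul_conjTranspose dA dB) X hρ.eigenvalues hR hRJ
  obtain ⟨τ, hτ, hτoff⟩ := exists_lex_enumeration dA dB
  have hmain := sum_negMulLog_blocks_le hp (fun i => hpe i ▸ hpos.eigenvalues_nonneg (e i))
    (d := fun j => dA (τ j).1) (fun i j h => hAnti (hτ h))
    (by rw [Equiv.sum_comp τ (fun x => dA x.1), Fintype.sum_sigma]; simp [mul_comm])
    (W := fun i j => W (e i) (τ j)) (T := fun x j => T (τ x) (τ j))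
    (fun i j => hW0 _ _) (fun x j => hT0 _ _)
    (fun i => (Equiv.sum_comp τ fun j => W (e i) j).trans (hW _))
    (fun x => (Equiv.sum_comp τ fun j => T (τ x) j).trans (hTr _))
    (fun j => (Equiv.sum_comp τ fun x => T x (τ j)).trans (hTc _))
    (fun j => by
      rw [Equiv.sum_comp e fun i => W i (τ j), hWT,
        Equiv.sum_comp τ fun x => (dA x.1 : ℝ) * T x (τ j)])
  have hq : ∀ j, ∑ a ∈ Finset.range (dA (τ j).1),
      extendZero p (∑ i ∈ Finset.range j, extendZero (fun i => dA (τ i).1) i + a) =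
        qval dA dB p (τ j).1 (τ j).2 := by
    intro j
    rw [hτoff, ← Fin.sum_univ_eq_sum_range (fun a => extendZero p (_ + a))]
    exact Finset.sum_congr rfl fun a _ => extendZero_val p (idx dA dB _ _ a)
  simp only [hq, hpe] at hmain
  rw [Equiv.sum_comp τ fun x => Real.negMulLog (qval dA dB p x.1 x.2), Fintype.sum_sigma] at hmain
  rw [vnEntropy, dif_pos hR, ge_iff_le]
  refine hmain.trans_eq ?_
  rw [Finset.sum_congr rfl fun j _ => congrArg Real.negMulLog
    ((Equiv.sum_comp e fun i => hρ.eigenvalues i * W i (τ j)).trans (hev (τ j)).symm)]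
  exact Equiv.sum_comp τ fun x => Real.negMulLog (hR.eigenvalues x)

end AQD
end

section
/- (Theorem 1, achievability part.) There exists a unitary matrix U in the unitary group of Matrix ι ι ℂ such that the von Neumann entropy of the partial trace over A of U ρ U* equals S(Tr_A (U ρ U*)) = Σ_{k : Fin K} Σ_{b : Fin (dB k)} (− q k b · Real.log (q k b)). -/
open scoped Classical Matrix ComplexOrder

namespace AQD

variable {K : ℕ}

/-- The entropy of a real diagonal matrix is the entropy of its diagonal. -/
theorem vnEntropy_diagonal {n : Type*} [Fintype n] [DecidableEq n] (d : n → ℝ) :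
    vnEntropy (Matrix.diagonal fun i => (d i : ℂ)) = ∑ i, (- d i * Real.log (d i)) := by
  have hM : (Matrix.diagonal fun i => (d i : ℂ)).IsHermitian := by
    rw [Matrix.isHermitian_diagonal_iff]
    intro i
    exact Complex.conj_ofReal (d i)
  have hroots := hM.roots_charpoly_eq_eigenvalues
  rw [Matrix.charpoly_diagonal, Polynomial.roots_prod _ _ (by
    simp [Finset.prod_ne_zero_iff, Polynomial.X_sub_C_ne_zero])] at hroots
  simp only [Polynomial.roots_X_sub_C, Multiset.bind_singleton] at hroots
  have h := congrArg (fun s => (s.map fun z : ℂ => - z.re * Real.log z.re).sum) hroots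
  simp only [Multiset.map_map] at h
  rw [vnEntropy, dif_pos hM]
  exact h.symm

theorem offset_add_le_offset (dA dB : Fin K → ℕ) {k l : Fin K} (hkl : k < l) :
    offset dA dB k + dA k * dB k ≤ offset dA dB l := by
  unfold offset
  rw [add_comm, ← Finset.sum_insert (f := fun k' => dA k' * dB k') (by simp)]
  refine Finset.sum_le_sum_of_subset fun j hj => ?_
  simp only [Finset.mem_insert, Finset.mem_Iio] at hj ⊢
  rcases hj with rfl | hj
  exacts [hkl, hj.trans hkl]

theorem idx_lt_offset_add (dA dB : Fin K → ℕ) (k : Fin K) (b : Fin (dB k)) (a : Fin (dA k)) :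
    (idx dA dB k b a : ℕ) < offset dA dB k + dA k * dB k := by
  have h := (finProdFinEquiv (b, a)).isLt
  simp only [finProdFinEquiv_apply_val] at h
  simp only [idx]
  linarith [mul_comm (dA k) (dB k), mul_comm (dA k) (b : ℕ)]

theorem idx_lt_idx (dA dB : Fin K → ℕ) {k l : Fin K} (hkl : k < l) (b : Fin (dB k))
    (a : Fin (dA k)) (b' : Fin (dB l)) (a' : Fin (dA l)) :
    (idx dA dB k b a : ℕ) < idx dA dB l b' a' := by
  have h₁ := idx_lt_offset_add dA dB k b a
  have h₂ := offset_add_le_offset dA dB hkl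
  have h₃ : offset dA dB l ≤ idx dA dB l b' a' := by simp only [idx]; omega
  omega

theorem idx_bijective (dA dB : Fin K → ℕ) :
    Function.Bijective fun x : (Σ k : Fin K, Fin (dA k) × Fin (dB k)) =>
      idx dA dB x.1 x.2.2 x.2.1 := by
  rw [Fintype.bijective_iff_injective_and_card]
  refine ⟨?_, by simp⟩
  rintro ⟨k, a, b⟩ ⟨l, a', b'⟩ h
  have hval := congrArg Fin.val h
  rcases lt_trichotomy k l with hkl | rfl | hkl
  · exact absurd hval (idx_lt_idx dA dB hkl b a b' a').ne
  · have hprod : (b, a) = (b', a') := by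
      apply finProdFinEquiv.injective
      apply Fin.ext
      simp only [idx] at hval
      simp only [finProdFinEquiv_apply_val]
      linarith [mul_comm (dA k) (b : ℕ), mul_comm (dA k) (b' : ℕ)]
    cases hprod
    rfl
  · exact absurd hval (idx_lt_idx dA dB hkl b' a' b a).ne'

/-- The partial trace of a diagonal matrix is diagonal. -/
theorem ptraceA_diagonal (dA dB : Fin K → ℕ)
    (d : (Σ k : Fin K, Fin (dA k) × Fin (dB k)) → ℂ) :
    ptraceA dA dB (Matrix.diagonal d) =
      Matrix.diagonal fun x => ∑ a : Fin (dA x.1), d ⟨x.1, (a, x.2)⟩ := by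
  ext ⟨k, b⟩ ⟨l, b'⟩
  by_cases hkl : l = k
  · subst hkl
    by_cases hb : b = b'
    · subst hb
      simp [ptraceA]
    · simp [ptraceA, hb]
  · have hne : (⟨k, b⟩ : Σ k : Fin K, Fin (dB k)) ≠ ⟨l, b'⟩ := fun h =>
      hkl (congrArg Sigma.fst h).symm
    simp [ptraceA, hkl, Matrix.diagonal_apply_ne _ hne]

/-- A Hermitian matrix is unitarily conjugate to the diagonal matrix of its eigenvalues, listed
in any order. -/
theorem exists_unitary_conj_eq_diagonal {n : Type*} [Fintype n] [DecidableEq n]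
    {A : Matrix n n ℂ} (hA : A.IsHermitian) (π : n ≃ n) :
    ∃ U : Matrix.unitaryGroup n ℂ, (U : Matrix n n ℂ) * A * (U : Matrix n n ℂ)ᴴ =
      Matrix.diagonal fun i => (hA.eigenvalues (π i) : ℂ) := by
  set V := hA.eigenvectorUnitary with hV
  have hVV : (V : Matrix n n ℂ)ᴴ * (V : Matrix n n ℂ) = 1 := Unitary.coe_star_mul_self V
  have hdiag : (V : Matrix n n ℂ)ᴴ * A * (V : Matrix n n ℂ) =
      Matrix.diagonal fun i => (hA.eigenvalues i : ℂ) := by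
    have h := hA.conjStarAlgAut_star_eigenvectorUnitary
    rw [Unitary.conjStarAlgAut_star_apply] at h
    exact h
  refine ⟨⟨(V : Matrix n n ℂ)ᴴ.submatrix π id, ?_⟩, ?_⟩
  · rw [Matrix.mem_unitaryGroup_iff, Matrix.star_eq_conjTranspose, Matrix.conjTranspose_submatrix,
      Matrix.conjTranspose_conjTranspose, ← Matrix.submatrix_mul _ _ _ _ _ Function.bijective_id,
      hVV, Matrix.submatrix_one_equiv]
  · change (V : Matrix n n ℂ)ᴴ.submatrix π id * A * ((V : Matrix n n ℂ)ᴴ.submatrix π id)ᴴ = _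
    rw [Matrix.conjTranspose_submatrix, Matrix.conjTranspose_conjTranspose]
    have h := congrArg (fun M => M.submatrix π π) hdiag
    simp only [Matrix.submatrix_diagonal_equiv] at h
    rw [Matrix.submatrix_mul _ _ _ id _ Function.bijective_id,
      Matrix.submatrix_mul _ _ _ id _ Function.bijective_id, Matrix.submatrix_id_id] at h
    exact h

/-- **Theorem 1 (achievability part).** There is a unitary `U` such that the von Neumann
entropy of the partial trace over `A` of `U ρ U*` equals `∑_k ∑_b (- q k b * log (q k b))`. -/
theorem entropy_lower_bound_achieved
    (dA dB : Fin K → ℕ) (hA : ∀ k, 1 ≤ dA k) (hB : ∀ k, 1 ≤ dB k) (hAnti : Antitone dA)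
    (ρ : Matrix (Σ k : Fin K, Fin (dA k) × Fin (dB k)) (Σ k : Fin K, Fin (dA k) × Fin (dB k)) ℂ)
    (hρ : ρ.IsHermitian) (hpos : ρ.PosSemidef) (htr : Matrix.trace ρ = 1)
    (p : Fin (∑ k', dA k' * dB k') → ℝ) (hp : Antitone p)
    (e : Fin (∑ k', dA k' * dB k') ≃ (Σ k : Fin K, Fin (dA k) × Fin (dB k)))
    (hpe : ∀ i, p i = hρ.eigenvalues (e i)) :
    ∃ U : Matrix.unitaryGroup (Σ k : Fin K, Fin (dA k) × Fin (dB k)) ℂ,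
      vnEntropy (ptraceA dA dB ((U : Matrix _ _ ℂ) * ρ * (U : Matrix _ _ ℂ)ᴴ)) =
        ∑ k : Fin K, ∑ b : Fin (dB k),
          (- qval dA dB p k b * Real.log (qval dA dB p k b)) := by
  obtain ⟨U, hU⟩ := exists_unitary_conj_eq_diagonal hρ
    ((Equiv.ofBijective _ (idx_bijective dA dB)).trans e)
  refine ⟨U, ?_⟩
  have hq : ptraceA dA dB ((U : Matrix _ _ ℂ) * ρ * (U : Matrix _ _ ℂ)ᴴ) =
      Matrix.diagonal fun x => (qval dA dB p x.1 x.2 : ℂ) := by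
    rw [hU, ptraceA_diagonal]
    simp [qval, hpe]
  rw [hq, vnEntropy_diagonal, Fintype.sum_sigma]

end AQD
end

section
/- (Theorem 1, special case where subsystem A has one site, lower-bound part.) Assume in addition that dA k = 1 for all k. Then for every unitary matrix U in the unitary group of Matrix ι ι ℂ, the von Neumann entropy of the partial trace over A of U ρ U* is at least the von Neumann entropy of ρ: S(Tr_A (U ρ U*)) ≥ S(ρ). -/
open scoped Classical Matrix ComplexOrder

namespace AQD

variable {K : ℕ}

/-- The entropy of a Hermitian matrix as a sum of `Real.negMulLog` over its eigenvalues. -/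
theorem vnEntropy_eq_sum_negMulLog {n : Type*} [Fintype n] [DecidableEq n] {M : Matrix n n ℂ}
    (hM : M.IsHermitian) : vnEntropy M = ∑ i, Real.negMulLog (hM.eigenvalues i) := by
  simp [vnEntropy, hM, Real.negMulLog]

/-- A concave function on `[0, ∞)`, summed over the coordinates of a nonnegative vector, does not
decrease when a doubly stochastic matrix is applied to the vector. -/
theorem concaveOn_sum_le_sum_of_doublyStochastic {m n : Type*} [Fintype m] [Fintype n]
    {f : ℝ → ℝ} (hf : ConcaveOn ℝ (Set.Ici 0) f) {D : m → n → ℝ} (hD : ∀ i j, 0 ≤ D i j)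
    (hrow : ∀ i, ∑ j, D i j = 1) (hcol : ∀ j, ∑ i, D i j = 1)
    {v : n → ℝ} (hv : ∀ j, 0 ≤ v j) :
    ∑ j, f (v j) ≤ ∑ i, f (∑ j, D i j * v j) := by
  calc ∑ j, f (v j) = ∑ j, ∑ i, D i j * f (v j) := by
        simp_rw [← Finset.sum_mul, hcol, one_mul]
    _ = ∑ i, ∑ j, D i j * f (v j) := Finset.sum_comm
    _ ≤ ∑ i, f (∑ j, D i j * v j) := Finset.sum_le_sum fun i _ =>
        hf.le_map_sum (fun j _ => hD i j) (hrow i) fun j _ => hv j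

/-- A unital, trace-preserving completely positive map, given by Kraus operators `C k`, does not
decrease the von Neumann entropy of a positive semidefinite matrix. -/
theorem vnEntropy_le_of_unital_kraus {κ m n : Type*} [Fintype κ] [Fintype m] [DecidableEq m]
    [Fintype n] [DecidableEq n] (C : κ → Matrix m n ℂ) (hunital : ∑ k, C k * (C k)ᴴ = 1)
    (htrace : ∑ k, (C k)ᴴ * C k = 1) {A : Matrix n n ℂ} (hA : A.PosSemidef) :
    vnEntropy A ≤ vnEntropy (∑ k, C k * A * (C k)ᴴ) := by
  have hB : (∑ k, C k * A * (C k)ᴴ).IsHermitian := by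
    simp only [Matrix.IsHermitian, Matrix.conjTranspose_sum]
    exact Finset.sum_congr rfl fun k _ => Matrix.isHermitian_mul_mul_conjTranspose (C k) hA.1
  rw [vnEntropy_eq_sum_negMulLog hA.1, vnEntropy_eq_sum_negMulLog hB]
  set V : Matrix n n ℂ := hA.1.eigenvectorUnitary.1
  set W : Matrix m m ℂ := hB.eigenvectorUnitary.1
  have hVV : V * Vᴴ = 1 := Unitary.coe_mul_star_self hA.1.eigenvectorUnitary
  have hVV' : Vᴴ * V = 1 := Unitary.coe_star_mul_self hA.1.eigenvectorUnitary
  have hWW : W * Wᴴ = 1 := Unitary.coe_mul_star_self hB.eigenvectorUnitary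
  have hWW' : Wᴴ * W = 1 := Unitary.coe_star_mul_self hB.eigenvectorUnitary
  have hdA : A = V * Matrix.diagonal (fun i => (hA.1.eigenvalues i : ℂ)) * Vᴴ :=
    hA.1.spectral_theorem
  have hdB : Wᴴ * (∑ k, C k * A * (C k)ᴴ) * W =
      Matrix.diagonal (fun i => (hB.eigenvalues i : ℂ)) := by
    have h := hB.conjStarAlgAut_star_eigenvectorUnitary
    rwa [Unitary.conjStarAlgAut_star_apply] at h
  set E : κ → Matrix m n ℂ := fun k => Wᴴ * C k * V with hE
  have hrowE : ∑ k, E k * (E k)ᴴ = 1 := by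
    calc ∑ k, E k * (E k)ᴴ = ∑ k, Wᴴ * (C k * (V * Vᴴ) * (C k)ᴴ) * W :=
          Finset.sum_congr rfl fun k _ => by
            simp [hE, Matrix.conjTranspose_mul, Matrix.mul_assoc]
      _ = 1 := by
          simp only [hVV, Matrix.mul_one]
          rw [← Matrix.sum_mul, ← Matrix.mul_sum, hunital, Matrix.mul_one, hWW']
  have hcolE : ∑ k, (E k)ᴴ * E k = 1 := by
    calc ∑ k, (E k)ᴴ * E k = ∑ k, Vᴴ * ((C k)ᴴ * (W * Wᴴ) * C k) * V :=
          Finset.sum_congr rfl fun k _ => by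
            simp [hE, Matrix.conjTranspose_mul, Matrix.mul_assoc]
      _ = 1 := by
          simp only [hWW, Matrix.mul_one]
          rw [← Matrix.sum_mul, ← Matrix.mul_sum, htrace, Matrix.mul_one, hVV']
  have hdiag : ∑ k, E k * Matrix.diagonal (fun i => (hA.1.eigenvalues i : ℂ)) * (E k)ᴴ =
      Matrix.diagonal (fun i => (hB.eigenvalues i : ℂ)) := by
    rw [← hdB, Matrix.mul_sum, Matrix.sum_mul]
    refine Finset.sum_congr rfl fun k _ => ?_
    conv_rhs => rw [hdA]
    simp [hE, Matrix.conjTranspose_mul, Matrix.mul_assoc]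
  have hμ : ∀ i, hB.eigenvalues i =
      ∑ j, (∑ k, Complex.normSq (E k i j)) * hA.1.eigenvalues j := by
    intro i
    have h := congrFun (congrFun hdiag i) i
    simp only [Matrix.sum_apply, Matrix.diagonal_apply_eq, Matrix.mul_apply (N := (E _)ᴴ),
      Matrix.mul_diagonal, Matrix.conjTranspose_apply] at h
    rw [← Complex.ofReal_inj, ← h, Finset.sum_comm]
    push_cast
    refine Finset.sum_congr rfl fun j _ => ?_
    rw [Finset.sum_mul]
    refine Finset.sum_congr rfl fun k _ => ?_
    rw [← Complex.mul_conj]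
    exact mul_right_comm _ _ _
  have hrow : ∀ i, ∑ j, ∑ k, Complex.normSq (E k i j) = 1 := by
    intro i
    have h := congrFun (congrFun hrowE i) i
    simp only [Matrix.sum_apply, Matrix.mul_apply, Matrix.conjTranspose_apply,
      Matrix.one_apply_eq, Complex.star_def, Complex.mul_conj] at h
    rw [Finset.sum_comm]
    exact_mod_cast h
  have hcol : ∀ j, ∑ i, ∑ k, Complex.normSq (E k i j) = 1 := by
    intro j
    have h := congrFun (congrFun hcolE j) j
    simp only [Matrix.sum_apply, Matrix.mul_apply, Matrix.conjTranspose_apply,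
      Matrix.one_apply_eq, Complex.star_def, mul_comm ((starRingEnd ℂ) _),
      Complex.mul_conj] at h
    rw [Finset.sum_comm]
    exact_mod_cast h
  simp_rw [hμ]
  exact concaveOn_sum_le_sum_of_doublyStochastic Real.concaveOn_negMulLog
    (fun i j => Finset.sum_nonneg fun k _ => Complex.normSq_nonneg _) hrow hcol
    hA.eigenvalues_nonneg

/-- The index equivalence when every `A`-factor is one-dimensional. -/
def sigmaEquivOfOne (dB : Fin K → ℕ) :
    (Σ k : Fin K, Fin (dB k)) ≃ (Σ k : Fin K, Fin 1 × Fin (dB k)) :=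
  Equiv.sigmaCongrRight fun _ => (Equiv.uniqueProd _ _).symm

/-- When every `A`-factor is one-dimensional, the partial trace over `A` is the block-diagonal
pinching of the reindexed matrix. -/
theorem ptraceA_one_eq_pinching (dB : Fin K → ℕ)
    (M : Matrix (Σ k : Fin K, Fin 1 × Fin (dB k)) (Σ k : Fin K, Fin 1 × Fin (dB k)) ℂ) :
    ptraceA (fun _ => 1) dB M =
      ∑ k : Fin K, Matrix.diagonal (fun x : Σ k : Fin K, Fin (dB k) => if x.1 = k then 1 else 0) *
        M.submatrix (sigmaEquivOfOne dB) (sigmaEquivOfOne dB) *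
        Matrix.diagonal (fun x : Σ k : Fin K, Fin (dB k) => if x.1 = k then 1 else 0) := by
  ext ⟨k, b⟩ ⟨k', b'⟩
  by_cases h : k' = k
  · subst h
    simp [ptraceA, Matrix.sum_apply, Matrix.mul_diagonal, Matrix.diagonal_mul, sigmaEquivOfOne,
      Equiv.sigmaCongrRight]
  · simp [ptraceA, Matrix.sum_apply, Matrix.mul_diagonal, Matrix.diagonal_mul, h, Ne.symm h]

/-- **Theorem 1, special case `dA k = 1` (lower-bound part).** If subsystem `A` has one site
(each `dA k = 1`), then for every unitary `U`, `S(Tr_A (U ρ U*)) ≥ S(ρ)`. -/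
theorem entropy_lower_bound_one_site
    (dA dB : Fin K → ℕ) (hA : ∀ k, 1 ≤ dA k) (hB : ∀ k, 1 ≤ dB k) (hAnti : Antitone dA)
    (hA1 : ∀ k, dA k = 1)
    (ρ : Matrix (Σ k : Fin K, Fin (dA k) × Fin (dB k)) (Σ k : Fin K, Fin (dA k) × Fin (dB k)) ℂ)
    (hρ : ρ.IsHermitian) (hpos : ρ.PosSemidef) (htr : Matrix.trace ρ = 1)
    (U : Matrix.unitaryGroup (Σ k : Fin K, Fin (dA k) × Fin (dB k)) ℂ) :
    vnEntropy (ptraceA dA dB ((U : Matrix _ _ ℂ) * ρ * (U : Matrix _ _ ℂ)ᴴ)) ≥ vnEntropy ρ := by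
  obtain rfl : dA = fun _ => 1 := funext hA1
  let P : Fin K → Matrix (Σ k : Fin K, Fin (dB k)) (Σ k : Fin K, Fin (dB k)) ℂ :=
    fun k => Matrix.diagonal fun x => if x.1 = k then 1 else 0
  let e := sigmaEquivOfOne dB
  let V : Matrix (Σ k : Fin K, Fin (dB k)) (Σ k : Fin K, Fin 1 × Fin (dB k)) ℂ :=
    (U : Matrix _ _ ℂ).submatrix e id
  have hPP : ∀ k, P k * P k = P k := fun k => by simp [P]
  have hPH : ∀ k, (P k)ᴴ = P k := fun k => by
    simp only [P, Matrix.diagonal_conjTranspose]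
    congr 1
    ext x
    by_cases h : x.1 = k <;> simp [h]
  have hP : ∑ k, P k = 1 := by
    ext x y
    by_cases h : x = y <;> simp [P, Matrix.sum_apply, Matrix.one_apply, h]
  have hVV : V * Vᴴ = 1 := by
    have h : U.1 * U.1ᴴ = 1 := Unitary.coe_mul_star_self U
    rw [Matrix.conjTranspose_submatrix, ← Matrix.submatrix_mul _ _ _ _ _ Function.bijective_id, h,
      Matrix.submatrix_one_equiv]
  have hVV' : Vᴴ * V = 1 := by
    have h : U.1ᴴ * U.1 = 1 := Unitary.coe_star_mul_self U
    rw [Matrix.conjTranspose_submatrix, ← Matrix.submatrix_mul _ _ _ _ _ e.bijective, h,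
      Matrix.submatrix_id_id]
  have hM : ((U : Matrix _ _ ℂ) * ρ * (U : Matrix _ _ ℂ)ᴴ).submatrix e e = V * ρ * Vᴴ := by
    rw [Matrix.conjTranspose_submatrix, Matrix.submatrix_mul _ _ _ id _ Function.bijective_id,
      Matrix.submatrix_mul _ _ _ id _ Function.bijective_id, Matrix.submatrix_id_id]
  have hchannel : ptraceA (fun _ => 1) dB ((U : Matrix _ _ ℂ) * ρ * (U : Matrix _ _ ℂ)ᴴ) =
      ∑ k, P k * V * ρ * (P k * V)ᴴ := by
    rw [ptraceA_one_eq_pinching]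
    refine Finset.sum_congr rfl fun k _ => ?_
    change P k * Matrix.submatrix _ e e * P k = _
    rw [hM, Matrix.conjTranspose_mul, hPH]
    simp only [Matrix.mul_assoc]
  rw [ge_iff_le, hchannel]
  refine vnEntropy_le_of_unital_kraus (fun k => P k * V) ?_ ?_ hpos
  · calc ∑ k, P k * V * (P k * V)ᴴ = ∑ k, P k * (V * Vᴴ) * P k :=
          Finset.sum_congr rfl fun k _ => by
            rw [Matrix.conjTranspose_mul, hPH]
            simp only [Matrix.mul_assoc]
      _ = 1 := by simp only [hVV, Matrix.mul_one, hPP, hP]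
  · calc ∑ k, (P k * V)ᴴ * (P k * V) = ∑ k, Vᴴ * (P k * P k) * V :=
          Finset.sum_congr rfl fun k _ => by
            rw [Matrix.conjTranspose_mul, hPH]
            simp only [Matrix.mul_assoc]
      _ = 1 := by
          simp only [hPP]
          rw [← Matrix.sum_mul, ← Matrix.mul_sum, hP, Matrix.mul_one, hVV']

end AQD
end

section
/- (Theorem 1, special case where subsystem A has one site, achievability part.) Assume in addition that dA k = 1 for all k. Then there exists a unitary matrix U in the unitary group of Matrix ι ι ℂ such that S(Tr_A (U ρ U*)) = S(ρ); consequently the minimum of S(Tr_A (U ρ U*)) over all unitaries U equals S(ρ). -/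
open scoped Classical Matrix ComplexOrder

namespace AQD

variable {K : ℕ}

/-- A channel with Kraus operators `E k` that is both unital and trace preserving does not decrease
the von Neumann entropy of a positive semidefinite matrix. -/
theorem vnEntropy_le_of_unital {m n κ : Type*} [Fintype m] [DecidableEq m] [Fintype n]
    [DecidableEq n] [Fintype κ] {M : Matrix n n ℂ} (hM : M.PosSemidef) (E : κ → Matrix m n ℂ)
    (h₁ : ∑ k, E k * (E k)ᴴ = 1) (h₂ : ∑ k, (E k)ᴴ * E k = 1) :
    vnEntropy M ≤ vnEntropy (∑ k, E k * M * (E k)ᴴ) := by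
  have hN : (∑ k, E k * M * (E k)ᴴ).PosSemidef :=
    Matrix.posSemidef_sum _ fun k _ => hM.mul_mul_conjTranspose_same (E k)
  set N := ∑ k, E k * M * (E k)ᴴ with hNdef
  set W : Matrix n n ℂ := (hM.isHermitian.eigenvectorUnitary : Matrix n n ℂ)
  set V : Matrix m m ℂ := (hN.isHermitian.eigenvectorUnitary : Matrix m m ℂ)
  have hW1 : W * Wᴴ = 1 := Matrix.mem_unitaryGroup_iff.1 hM.isHermitian.eigenvectorUnitary.2
  have hW2 : Wᴴ * W = 1 := Matrix.mem_unitaryGroup_iff'.1 hM.isHermitian.eigenvectorUnitary.2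
  have hV1 : V * Vᴴ = 1 := Matrix.mem_unitaryGroup_iff.1 hN.isHermitian.eigenvectorUnitary.2
  have hV2 : Vᴴ * V = 1 := Matrix.mem_unitaryGroup_iff'.1 hN.isHermitian.eigenvectorUnitary.2
  set l := hM.isHermitian.eigenvalues
  set μ := hN.isHermitian.eigenvalues
  have specM : M = W * Matrix.diagonal (fun j => (l j : ℂ)) * Wᴴ := hM.isHermitian.spectral_theorem
  have specN : N = V * Matrix.diagonal (fun j => (μ j : ℂ)) * Vᴴ := hN.isHermitian.spectral_theorem
  let C : κ → Matrix m n ℂ := fun k => Vᴴ * E k * W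
  have hC (k : κ) : (C k)ᴴ = Wᴴ * (E k)ᴴ * V := by
    simp [C, Matrix.conjTranspose_mul, Matrix.mul_assoc]
  have hrow : ∑ k, C k * (C k)ᴴ = 1 := by
    have h (k : κ) : C k * (C k)ᴴ = Vᴴ * (E k * (E k)ᴴ) * V := by
      calc C k * (C k)ᴴ = Vᴴ * E k * (W * Wᴴ) * (E k)ᴴ * V := by
            rw [hC]; simp only [C, Matrix.mul_assoc]
        _ = _ := by rw [hW1]; simp only [Matrix.mul_assoc, Matrix.mul_one]
    simp_rw [h, ← Finset.sum_mul, ← Finset.mul_sum]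
    rw [h₁, Matrix.mul_one, hV2]
  have hcol : ∑ k, (C k)ᴴ * C k = 1 := by
    have h (k : κ) : (C k)ᴴ * C k = Wᴴ * ((E k)ᴴ * E k) * W := by
      calc (C k)ᴴ * C k = Wᴴ * (E k)ᴴ * (V * Vᴴ) * E k * W := by
            rw [hC]; simp only [C, Matrix.mul_assoc]
        _ = _ := by rw [hV1]; simp only [Matrix.mul_assoc, Matrix.mul_one]
    simp_rw [h, ← Finset.sum_mul, ← Finset.mul_sum]
    rw [h₂, Matrix.mul_one, hW2]
  have hdiag : Matrix.diagonal (fun j => (μ j : ℂ)) =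
      ∑ k, C k * Matrix.diagonal (fun j => (l j : ℂ)) * (C k)ᴴ := by
    have h (k : κ) : C k * Matrix.diagonal (fun j => (l j : ℂ)) * (C k)ᴴ =
        Vᴴ * (E k * M * (E k)ᴴ) * V := by
      rw [hC, specM]; simp only [C, Matrix.mul_assoc]
    simp_rw [h, ← Finset.sum_mul, ← Finset.mul_sum]
    rw [← hNdef, specN]
    calc _ = (Vᴴ * V) * Matrix.diagonal (fun j => (μ j : ℂ)) * (Vᴴ * V) := by
          rw [hV2, Matrix.one_mul, Matrix.mul_one]
      _ = _ := by simp only [Matrix.mul_assoc]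
  let A : m → n → ℝ := fun i j => ∑ k, Complex.normSq (C k i j)
  have hA0 (i : m) (j : n) : 0 ≤ A i j := Finset.sum_nonneg fun k _ => Complex.normSq_nonneg _
  have hA1 (i : m) : ∑ j, A i j = 1 := by
    have h := congrFun (congrFun hrow i) i
    simp only [Matrix.sum_apply, Matrix.mul_apply, Matrix.conjTranspose_apply,
      Matrix.one_apply_eq, RCLike.star_def, Complex.mul_conj] at h
    rw [Finset.sum_comm] at h
    exact_mod_cast h
  have hA2 (j : n) : ∑ i, A i j = 1 := by
    have h := congrFun (congrFun hcol j) j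
    simp only [Matrix.sum_apply, Matrix.mul_apply, Matrix.conjTranspose_apply,
      Matrix.one_apply_eq, RCLike.star_def, mul_comm (starRingEnd ℂ _), Complex.mul_conj] at h
    rw [Finset.sum_comm] at h
    exact_mod_cast h
  have hA3 (i : m) : ∑ j, A i j * l j = μ i := by
    have hk (k : κ) : (C k * Matrix.diagonal (fun j => (l j : ℂ)) * (C k)ᴴ) i i =
        ∑ j, (Complex.normSq (C k i j) : ℂ) * l j := by
      rw [Matrix.mul_apply]
      refine Finset.sum_congr rfl fun j _ => ?_
      rw [Matrix.mul_diagonal, Matrix.conjTranspose_apply, RCLike.star_def, mul_right_comm,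
        Complex.mul_conj]
    have h := congrFun (congrFun hdiag i) i
    simp only [Matrix.sum_apply, Matrix.diagonal_apply_eq, hk] at h
    rw [Finset.sum_comm] at h
    simp only [A, Finset.sum_mul]
    exact_mod_cast h.symm
  have hMe : vnEntropy M = ∑ j, Real.negMulLog (l j) := by
    rw [vnEntropy, dif_pos hM.isHermitian]; rfl
  have hNe : vnEntropy N = ∑ i, Real.negMulLog (μ i) := by
    rw [vnEntropy, dif_pos hN.isHermitian]; rfl
  rw [hMe, hNe]
  calc ∑ j, Real.negMulLog (l j) = ∑ j, ∑ i, A i j * Real.negMulLog (l j) := by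
        simp_rw [← Finset.sum_mul, hA2, one_mul]
    _ = ∑ i, ∑ j, A i j * Real.negMulLog (l j) := Finset.sum_comm
    _ ≤ ∑ i, Real.negMulLog (μ i) := Finset.sum_le_sum fun i _ => by
        have h := Real.concaveOn_negMulLog.le_map_sum (t := Finset.univ) (w := A i) (p := l)
          (fun j _ => hA0 i j) (hA1 i) (fun j _ => hM.eigenvalues_nonneg j)
        simpa only [smul_eq_mul, hA3] using h

/-- Conjugation by a unitary between two index types preserves the von Neumann entropy. -/
theorem vnEntropy_conj_eq {m n : Type*} [Fintype m] [DecidableEq m] [Fintype n] [DecidableEq n]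
    {M : Matrix n n ℂ} (hM : M.PosSemidef) (R : Matrix m n ℂ) (h₁ : R * Rᴴ = 1)
    (h₂ : Rᴴ * R = 1) : vnEntropy (R * M * Rᴴ) = vnEntropy M := by
  apply le_antisymm
  · have h := vnEntropy_le_of_unital (hM.mul_mul_conjTranspose_same R) (fun _ : Unit => Rᴴ)
      (by simpa using h₂) (by simpa using h₁)
    have hR : Rᴴ * (R * M * Rᴴ) * R = M := by
      calc Rᴴ * (R * M * Rᴴ) * R = (Rᴴ * R) * M * (Rᴴ * R) := by simp only [Matrix.mul_assoc]
        _ = M := by rw [h₂, Matrix.one_mul, Matrix.mul_one]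
    simpa [hR] using h
  · simpa using vnEntropy_le_of_unital hM (fun _ : Unit => R) (by simpa using h₁)
      (by simpa using h₂)

/-- When every `dA k` is `1`, the indices of the `B`-blocks are those of the whole system. -/
def oneSiteEquiv (dA dB : Fin K → ℕ) (hA1 : ∀ k, dA k = 1) :
    (Σ k : Fin K, Fin (dB k)) ≃ (Σ k : Fin K, Fin (dA k) × Fin (dB k)) :=
  Equiv.sigmaCongrRight fun k =>
    ((Equiv.prodCongr ((finCongr (hA1 k)).trans finOneEquiv) (Equiv.refl (Fin (dB k)))).trans
      (Equiv.punitProd _)).symm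

theorem ptraceA_apply_of_one_site (dA dB : Fin K → ℕ) (hA1 : ∀ k, dA k = 1)
    (M : Matrix (Σ k : Fin K, Fin (dA k) × Fin (dB k)) (Σ k : Fin K, Fin (dA k) × Fin (dB k)) ℂ)
    (x y : Σ k : Fin K, Fin (dB k)) :
    ptraceA dA dB M x y = if x.1 = y.1 then
      M (oneSiteEquiv dA dB hA1 x) (oneSiteEquiv dA dB hA1 y) else 0 := by
  obtain ⟨k, b⟩ := x
  obtain ⟨k', b'⟩ := y
  by_cases h : k = k'
  · subst h
    have : Subsingleton (Fin (dA k)) := by rw [hA1 k]; infer_instance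
    simp only [ptraceA, dite_true, if_true]
    exact Fintype.sum_subsingleton _ ((finCongr (hA1 k)).symm 0)
  · simp [ptraceA, h, Ne.symm h]

/-- The projection onto the block `k`. -/
noncomputable def blockProj (dB : Fin K → ℕ) (k : Fin K) :
    Matrix (Σ k : Fin K, Fin (dB k)) (Σ k : Fin K, Fin (dB k)) ℂ :=
  Matrix.diagonal fun x => if x.1 = k then 1 else 0

theorem blockProj_conjTranspose (dB : Fin K → ℕ) (k : Fin K) :
    (blockProj dB k)ᴴ = blockProj dB k := by
  rw [blockProj, Matrix.diagonal_conjTranspose]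
  congr 1
  ext x
  by_cases hx : x.1 = k <;> simp [hx]

theorem blockProj_mul_self (dB : Fin K → ℕ) (k : Fin K) :
    blockProj dB k * blockProj dB k = blockProj dB k := by
  simp [blockProj, Matrix.diagonal_mul_diagonal]

theorem sum_blockProj (dB : Fin K → ℕ) : ∑ k, blockProj dB k = 1 := by
  ext x y
  simp only [blockProj, Matrix.sum_apply, Matrix.diagonal_apply, Matrix.one_apply]
  by_cases hxy : x = y <;> simp [hxy]

/-- When every `dA k` is `1`, the partial trace is a pinching onto the blocks. -/
theorem ptraceA_eq_sum_of_one_site (dA dB : Fin K → ℕ) (hA1 : ∀ k, dA k = 1)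
    (M : Matrix (Σ k : Fin K, Fin (dA k) × Fin (dB k)) (Σ k : Fin K, Fin (dA k) × Fin (dB k)) ℂ) :
    ptraceA dA dB M = ∑ k, blockProj dB k *
      M.submatrix (oneSiteEquiv dA dB hA1) (oneSiteEquiv dA dB hA1) * (blockProj dB k)ᴴ := by
  ext x y
  rw [ptraceA_apply_of_one_site dA dB hA1]
  simp only [blockProj_conjTranspose]
  simp only [blockProj, Matrix.sum_apply, Matrix.mul_diagonal, Matrix.diagonal_mul,
    Matrix.submatrix_apply]
  rw [Finset.sum_eq_single x.1]
  · by_cases hxy : x.1 = y.1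
    · simp [hxy]
    · simp [hxy, Ne.symm hxy]
  · intro k _ hk
    simp [Ne.symm hk]
  · simp

/-- Unitary conjugation followed by reindexing preserves positivity and the entropy. -/
theorem posSemidef_and_vnEntropy_submatrix_conj {m n : Type*} [Fintype m] [DecidableEq m]
    [Fintype n] [DecidableEq n] {M : Matrix n n ℂ} (hM : M.PosSemidef) (e : m ≃ n)
    (U : Matrix.unitaryGroup n ℂ) :
    (((U : Matrix n n ℂ) * M * (U : Matrix n n ℂ)ᴴ).submatrix e e).PosSemidef ∧
      vnEntropy (((U : Matrix n n ℂ) * M * (U : Matrix n n ℂ)ᴴ).submatrix e e) = vnEntropy M := by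
  have h₁ : (U : Matrix n n ℂ) * (U : Matrix n n ℂ)ᴴ = 1 := Matrix.mem_unitaryGroup_iff.1 U.2
  have h₂ : (U : Matrix n n ℂ)ᴴ * (U : Matrix n n ℂ) = 1 := Matrix.mem_unitaryGroup_iff'.1 U.2
  have hR : ((U : Matrix n n ℂ) * M * (U : Matrix n n ℂ)ᴴ).submatrix e e =
      (U : Matrix n n ℂ).submatrix e id * M * ((U : Matrix n n ℂ).submatrix e id)ᴴ := by
    ext x y
    simp [Matrix.mul_apply]
  refine ⟨(hM.mul_mul_conjTranspose_same _).submatrix e, ?_⟩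
  rw [hR]
  apply vnEntropy_conj_eq hM
  · rw [Matrix.conjTranspose_submatrix, ← Matrix.submatrix_mul _ _ e id e Function.bijective_id,
      h₁, Matrix.submatrix_one_equiv]
  · rw [Matrix.conjTranspose_submatrix, ← Matrix.submatrix_mul _ _ id e id e.bijective, h₂,
      Matrix.submatrix_id_id]

/-- **Theorem 1, special case `dA k = 1` (achievability part).** If subsystem `A` has one site
(each `dA k = 1`), then `S(ρ)` is attained by some unitary `U` and is the minimum of
`S(Tr_A (U ρ U*))` over all unitaries `U`. -/
theorem entropy_min_one_site
    (dA dB : Fin K → ℕ) (hA : ∀ k, 1 ≤ dA k) (hB : ∀ k, 1 ≤ dB k) (hAnti : Antitone dA)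
    (hA1 : ∀ k, dA k = 1)
    (ρ : Matrix (Σ k : Fin K, Fin (dA k) × Fin (dB k)) (Σ k : Fin K, Fin (dA k) × Fin (dB k)) ℂ)
    (hρ : ρ.IsHermitian) (hpos : ρ.PosSemidef) (htr : Matrix.trace ρ = 1) :
    IsLeast
      (Set.range fun U : Matrix.unitaryGroup (Σ k : Fin K, Fin (dA k) × Fin (dB k)) ℂ =>
        vnEntropy (ptraceA dA dB ((U : Matrix _ _ ℂ) * ρ * (U : Matrix _ _ ℂ)ᴴ)))
      (vnEntropy ρ) := by
  set e := oneSiteEquiv dA dB hA1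
  constructor
  · refine ⟨star hρ.eigenvectorUnitary, ?_⟩
    set U := star hρ.eigenvectorUnitary
    have hd : (U : Matrix _ _ ℂ) * ρ * (U : Matrix _ _ ℂ)ᴴ =
        Matrix.diagonal (fun j => (hρ.eigenvalues j : ℂ)) := by
      have h := hρ.conjStarAlgAut_star_eigenvectorUnitary
      rw [Unitary.conjStarAlgAut_apply] at h
      exact h
    have hp : ptraceA dA dB ((U : Matrix _ _ ℂ) * ρ * (U : Matrix _ _ ℂ)ᴴ) =
        ((U : Matrix _ _ ℂ) * ρ * (U : Matrix _ _ ℂ)ᴴ).submatrix e e := by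
      rw [hd]
      ext x y
      rw [ptraceA_apply_of_one_site dA dB hA1, Matrix.submatrix_apply]
      split_ifs with hxy
      · rfl
      · rw [Matrix.diagonal_apply_ne]
        exact fun h => hxy (congrArg Sigma.fst (e.injective h))
    simp only [hp]
    exact (posSemidef_and_vnEntropy_submatrix_conj hpos e U).2
  · rintro _ ⟨U, rfl⟩
    obtain ⟨hps, hS⟩ := posSemidef_and_vnEntropy_submatrix_conj hpos e U
    simp only [ptraceA_eq_sum_of_one_site dA dB hA1]
    rw [← hS]
    apply vnEntropy_le_of_unital hps
    · simp_rw [blockProj_conjTranspose, blockProj_mul_self, sum_blockProj]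
    · simp_rw [blockProj_conjTranspose, blockProj_mul_self, sum_blockProj]

end AQD
end

section
/- (Pinching majorization, proof step of Theorem 1.) Let ι and κ be finite types, f : ι → κ, and let M : Matrix ι ι ℂ be Hermitian. Define the pinched matrix P(M) by P(M) i j = M i j if f i = f j, and 0 otherwise. Then P(M) is Hermitian and its eigenvalue vector is majorized by that of M: letting μ, λ : Fin (card ι) → ℝ denote the eigenvalues of P(M) and of M, each listed in decreasing order, one has Σ_{i<m} μ i ≤ Σ_{i<m} λ i for every m ≤ card ι, and Σ_i μ i = Σ_i λ i. -/
open scoped Classical Matrix ComplexOrder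

namespace AQD

/-- The pinching of a matrix along a function `f`: keep the entry `M i j` when `f i = f j`
and replace it by `0` otherwise. -/
def pinch {ι κ : Type*} [DecidableEq κ] (f : ι → κ) (M : Matrix ι ι ℂ) : Matrix ι ι ℂ :=
  fun i j => if f i = f j then M i j else 0

/-- A bounded weight of total mass `m` pairs with a decreasing vector to at most the sum of its
first `m` entries. -/
lemma sum_mul_le_sum_filter_lt {n m : ℕ} (hm : m ≤ n) {x w : Fin n → ℝ} (hx : Antitone x)
    (hw0 : ∀ a, 0 ≤ w a) (hw1 : ∀ a, w a ≤ 1) (hw : ∑ a, w a = m) :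
    ∑ a, w a * x a ≤ ∑ a ∈ Finset.univ.filter (fun a : Fin n => (a : ℕ) < m), x a := by
  rcases Nat.eq_zero_or_pos m with rfl | hpos
  · have hw' : ∀ a, w a = 0 := by
      have := (Finset.sum_eq_zero_iff_of_nonneg (fun a _ => hw0 a)).1 (by simpa using hw)
      exact fun a => this a (Finset.mem_univ a)
    simp [hw']
  · set c := x ⟨m - 1, by omega⟩ with hc
    have hcard : ∑ a : Fin n, (if (a : ℕ) < m then (1 : ℝ) else 0) = m := by
      rw [Finset.sum_boole, Fin.card_filter_val_lt, min_eq_right hm]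
    have key : 0 ≤ ∑ a : Fin n, ((if (a : ℕ) < m then (1 : ℝ) else 0) - w a) * (x a - c) := by
      refine Finset.sum_nonneg fun a _ => ?_
      split_ifs with h
      · have : c ≤ x a := hx (Fin.mk_le_mk.2 (by omega) : a ≤ ⟨m - 1, _⟩)
        exact mul_nonneg (by linarith [hw1 a]) (by linarith)
      · have : x a ≤ c := hx (Fin.mk_le_mk.2 (by omega) : (⟨m - 1, _⟩ : Fin n) ≤ a)
        exact mul_nonneg_of_nonpos_of_nonpos (by linarith [hw0 a]) (by linarith)
    have expand : ∑ a : Fin n, ((if (a : ℕ) < m then (1 : ℝ) else 0) - w a) * (x a - c) =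
        ∑ a : Fin n, (if (a : ℕ) < m then x a else 0) - ∑ a, w a * x a
          - c * (∑ a : Fin n, (if (a : ℕ) < m then (1 : ℝ) else 0) - ∑ a, w a) := by
      rw [← Finset.sum_sub_distrib, ← Finset.sum_sub_distrib, Finset.mul_sum,
        ← Finset.sum_sub_distrib]
      refine Finset.sum_congr rfl fun a _ => ?_
      split_ifs <;> ring
    rw [Finset.sum_filter]
    rw [expand, hcard, hw] at key
    linarith

/-- The image of a decreasing vector under a doubly stochastic matrix is majorized by it. -/
lemma doublyStochastic_mulVec_majorized {n : ℕ} {D : Matrix (Fin n) (Fin n) ℝ}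
    (hD : D ∈ doublyStochastic ℝ (Fin n)) {x : Fin n → ℝ} (hx : Antitone x) :
    (∀ m ≤ n, ∑ i ∈ Finset.univ.filter (fun i : Fin n => (i : ℕ) < m), (D *ᵥ x) i ≤
      ∑ i ∈ Finset.univ.filter (fun i : Fin n => (i : ℕ) < m), x i) ∧
      ∑ i, (D *ᵥ x) i = ∑ i, x i := by
  obtain ⟨h0, hrow, hcol⟩ := mem_doublyStochastic_iff_sum.1 hD
  have swap (s : Finset (Fin n)) : ∑ i ∈ s, (D *ᵥ x) i = ∑ a, (∑ i ∈ s, D i a) * x a := by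
    simp only [Matrix.mulVec, dotProduct, Finset.sum_mul]
    exact Finset.sum_comm
  refine ⟨fun m hm => ?_, by simp [swap, hcol]⟩
  rw [swap]
  refine sum_mul_le_sum_filter_lt hm hx (fun a => Finset.sum_nonneg fun i _ => h0 i a)
    (fun a => ?_) ?_
  · rw [← hcol a]
    exact Finset.sum_le_sum_of_subset_of_nonneg (Finset.subset_univ _) fun i _ _ => h0 i a
  · rw [Finset.sum_comm]
    simp [hrow, Fin.card_filter_val_lt, hm]

section Pinching

variable {ι κ : Type*} [DecidableEq κ]

lemma isHermitian_pinch (f : ι → κ) {M : Matrix ι ι ℂ} (hM : M.IsHermitian) :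
    (pinch f M).IsHermitian := by
  ext i j
  simp only [Matrix.conjTranspose_apply, pinch, eq_comm (a := f j)]
  split_ifs
  · exact hM.apply i j
  · exact star_zero ℂ

variable [DecidableEq ι]

lemma pinch_one (f : ι → κ) : pinch f (1 : Matrix ι ι ℂ) = 1 := by
  ext i j
  by_cases h : i = j <;> simp [pinch, Matrix.one_apply, h]

/-- The diagonal projection onto the coordinates in the fibre of `f` over `k`. -/
def fibreProj (f : ι → κ) (k : κ) : Matrix ι ι ℂ :=
  Matrix.diagonal fun i => if f i = k then 1 else 0

lemma conjTranspose_fibreProj (f : ι → κ) (k : κ) : (fibreProj f k)ᴴ = fibreProj f k := by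
  rw [fibreProj, Matrix.diagonal_conjTranspose]
  congr 1
  ext i
  simp [apply_ite]

variable [Fintype ι] [Fintype κ]

lemma pinch_eq_sum (f : ι → κ) (M : Matrix ι ι ℂ) :
    pinch f M = ∑ k, fibreProj f k * M * fibreProj f k := by
  ext i j
  simp [pinch, fibreProj, Matrix.sum_apply, Matrix.mul_diagonal, Matrix.diagonal_mul]

/-- The squared overlaps, summed over the fibres of `f`, of the columns of `U` and `V`. -/
def overlap (f : ι → κ) (U V : Matrix ι ι ℂ) : Matrix ι ι ℝ :=
  fun j a => ∑ k, Complex.normSq ((Vᴴ * fibreProj f k * U) a j)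

lemma sum_overlap_mul (f : ι → κ) (U V : Matrix ι ι ℂ) (x : ι → ℝ) (j : ι) :
    ((∑ a, overlap f U V j a * x a : ℝ) : ℂ) =
      (Uᴴ * pinch f (V * Matrix.diagonal (fun a => (x a : ℂ)) * Vᴴ) * U) j j := by
  have h (k : κ) : Uᴴ * (fibreProj f k * (V * Matrix.diagonal (fun a => (x a : ℂ)) * Vᴴ) *
      fibreProj f k) * U = (Vᴴ * fibreProj f k * U)ᴴ * Matrix.diagonal (fun a => (x a : ℂ)) *
        (Vᴴ * fibreProj f k * U) := by
    simp only [Matrix.conjTranspose_mul, Matrix.conjTranspose_conjTranspose,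
      conjTranspose_fibreProj, Matrix.mul_assoc]
  rw [pinch_eq_sum, Finset.mul_sum, Finset.sum_mul]
  simp only [h, Matrix.sum_apply, overlap, Finset.sum_mul, Complex.ofReal_sum, Complex.ofReal_mul]
  rw [Finset.sum_comm]
  refine Finset.sum_congr rfl fun k _ => ?_
  rw [Matrix.mul_apply]
  refine Finset.sum_congr rfl fun a _ => ?_
  rw [Matrix.mul_diagonal, Matrix.conjTranspose_apply, Complex.normSq_eq_conj_mul_self,
    starRingEnd_apply]
  ring

lemma sum_overlap (f : ι → κ) {U V : Matrix ι ι ℂ} (hU : Uᴴ * U = 1) (hV : V * Vᴴ = 1) (j : ι) :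
    ∑ a, overlap f U V j a = 1 := by
  have h := sum_overlap_mul f U V (fun _ => 1) j
  simp only [mul_one, Complex.ofReal_one, Matrix.diagonal_one, hV, pinch_one, hU,
    Matrix.one_apply_eq] at h
  exact_mod_cast h

lemma overlap_comm (f : ι → κ) (U V : Matrix ι ι ℂ) (j a : ι) :
    overlap f U V j a = overlap f V U a j := by
  refine Finset.sum_congr rfl fun k _ => ?_
  have h : Uᴴ * fibreProj f k * V = (Vᴴ * fibreProj f k * U)ᴴ := by
    simp only [Matrix.conjTranspose_mul, Matrix.conjTranspose_conjTranspose,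
      conjTranspose_fibreProj, Matrix.mul_assoc]
  rw [h, Matrix.conjTranspose_apply, ← starRingEnd_apply, Complex.normSq_conj]

lemma overlap_mem_doublyStochastic (f : ι → κ) {U V : Matrix ι ι ℂ} (hU : Uᴴ * U = 1)
    (hV : Vᴴ * V = 1) : overlap f U V ∈ doublyStochastic ℝ ι := by
  refine mem_doublyStochastic_iff_sum.2 ⟨fun j a => Finset.sum_nonneg fun k _ =>
    Complex.normSq_nonneg _, fun j => sum_overlap f hU (mul_eq_one_comm.1 hV) j, fun a => ?_⟩
  simp only [overlap_comm f U V]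
  exact sum_overlap f hV (mul_eq_one_comm.1 hU) a

lemma conjTranspose_eigenvectorUnitary_mul {M : Matrix ι ι ℂ} (hM : M.IsHermitian) :
    (hM.eigenvectorUnitary : Matrix ι ι ℂ)ᴴ * hM.eigenvectorUnitary = 1 :=
  Unitary.coe_star_mul_self hM.eigenvectorUnitary

/-- The eigenvalues of a pinching are a doubly stochastic average of those of the matrix. -/
lemma eigenvalues_pinch (f : ι → κ) {M : Matrix ι ι ℂ} (hM : M.IsHermitian)
    (hP : (pinch f M).IsHermitian) :
    hP.eigenvalues =
      overlap f hP.eigenvectorUnitary hM.eigenvectorUnitary *ᵥ hM.eigenvalues := by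
  ext j
  have spec {A : Matrix ι ι ℂ} (hA : A.IsHermitian) : A = (hA.eigenvectorUnitary : Matrix ι ι ℂ) *
      Matrix.diagonal (fun a => (hA.eigenvalues a : ℂ)) *
        (hA.eigenvectorUnitary : Matrix ι ι ℂ)ᴴ := hA.spectral_theorem
  have h := sum_overlap_mul f hP.eigenvectorUnitary hM.eigenvectorUnitary hM.eigenvalues j
  have hdiag : (hP.eigenvectorUnitary : Matrix ι ι ℂ)ᴴ * pinch f M * hP.eigenvectorUnitary =
      Matrix.diagonal (fun a => (hP.eigenvalues a : ℂ)) := by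
    have hU := conjTranspose_eigenvectorUnitary_mul hP
    generalize hD : Matrix.diagonal (fun a => (hP.eigenvalues a : ℂ)) = D
    have hs := spec hP
    rw [hD] at hs
    generalize (hP.eigenvectorUnitary : Matrix ι ι ℂ) = U at hU hs ⊢
    rw [hs, Matrix.mul_assoc, Matrix.mul_assoc, hU, Matrix.mul_one, ← Matrix.mul_assoc, hU,
      Matrix.one_mul]
  rw [← spec hM, hdiag, Matrix.diagonal_apply_eq] at h
  exact_mod_cast h.symm

end Pinching

/-- **Pinching majorization.** If `M` is Hermitian then its pinching `P(M)` is Hermitian, and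
the decreasingly sorted eigenvalue vector of `P(M)` is majorized by that of `M`: all partial
sums of the former are at most those of the latter, and the total sums agree. -/
theorem pinch_eigenvalues_majorized {ι κ : Type*} [Fintype ι] [DecidableEq ι]
    [Fintype κ] [DecidableEq κ] (f : ι → κ) (M : Matrix ι ι ℂ) (hM : M.IsHermitian) :
    ∃ hP : (pinch f M).IsHermitian,
      ∀ (μ lam : Fin (Fintype.card ι) → ℝ), Antitone μ → Antitone lam →
        (∃ e : Fin (Fintype.card ι) ≃ ι, ∀ i, μ i = hP.eigenvalues (e i)) →
        (∃ e : Fin (Fintype.card ι) ≃ ι, ∀ i, lam i = hM.eigenvalues (e i)) →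
        (∀ m ≤ Fintype.card ι,
            ∑ i ∈ Finset.univ.filter (fun i : Fin (Fintype.card ι) => (i : ℕ) < m), μ i ≤
              ∑ i ∈ Finset.univ.filter (fun i : Fin (Fintype.card ι) => (i : ℕ) < m), lam i) ∧
          ∑ i, μ i = ∑ i, lam i := by
  refine ⟨isHermitian_pinch f hM, ?_⟩
  rintro μ lam - hlam ⟨e, he⟩ ⟨e', he'⟩
  set hP := isHermitian_pinch f hM
  set D := overlap f (hP.eigenvectorUnitary : Matrix ι ι ℂ) hM.eigenvectorUnitary
  obtain ⟨h0, hrow, hcol⟩ := mem_doublyStochastic_iff_sum.1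
    (overlap_mem_doublyStochastic f (conjTranspose_eigenvectorUnitary_mul hP)
      (conjTranspose_eigenvectorUnitary_mul hM) : D ∈ doublyStochastic ℝ ι)
  have hD : D.submatrix e e' ∈ doublyStochastic ℝ (Fin (Fintype.card ι)) :=
    mem_doublyStochastic_iff_sum.2 ⟨fun i a => h0 _ _,
      fun i => (e'.sum_comp fun a => D (e i) a).trans (hrow _),
      fun a => (e.sum_comp fun i => D i (e' a)).trans (hcol _)⟩
  have hμ : μ = D.submatrix e e' *ᵥ lam := by
    ext i
    rw [he, eigenvalues_pinch f hM hP]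
    simp only [Matrix.mulVec, dotProduct, Matrix.submatrix_apply, he']
    exact (e'.sum_comp fun a => D (e i) a * hM.eigenvalues a).symm
  rw [hμ]
  exact doublyStochastic_mulVec_majorized hD hlam

end AQD
end

section
/- (Entropy form of the optimal arrangement lemma.) Let K : ℕ, dA dB : Fin K → ℕ with dA k ≥ 1, dB k ≥ 1, and dA antitone; set D := Σ_k dA k · dB k and offset k := Σ_{k'<k} dA k' · dB k'. Let p : Fin D → ℝ be nonnegative, antitone, with Σ_i p i = 1. For a permutation σ of Fin D define qσ k b := Σ_{a : Fin (dA k)} p (σ (offset k + b · (dA k) + a)), and let q := q_id. Then for every permutation σ: Σ_{k,b} (− qσ k b · Real.log (qσ k b)) ≥ Σ_{k,b} (− q k b · Real.log (q k b)) (with the convention 0 · log 0 = 0). -/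
open scoped Classical Matrix ComplexOrder

namespace AQD

variable {K : ℕ}

theorem exists_isLowerSet_card_eq {X : Type*} [Fintype X] [LinearOrder X] {n : ℕ}
    (hn : n ≤ Fintype.card X) :
    ∃ I : Finset X, I.card = n ∧ ∀ u ∈ I, ∀ v ∉ I, u < v := by
  induction n with
  | zero => exact ⟨∅, by simp⟩
  | succ n ih =>
    obtain ⟨I, hI, hlow⟩ := ih (by omega)
    have hne : Iᶜ.Nonempty := by
      rw [← Finset.card_pos, Finset.card_compl]
      omega
    obtain ⟨m, hm, hmin⟩ := Finset.exists_min_image Iᶜ id hne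
    rw [Finset.mem_compl] at hm
    refine ⟨insert m I, by rw [Finset.card_insert_of_notMem hm, hI], fun u hu v hv => ?_⟩
    rw [Finset.mem_insert, not_or] at hv
    rcases Finset.mem_insert.1 hu with rfl | hu
    · exact lt_of_le_of_ne (hmin v (Finset.mem_compl.2 hv.2)) (Ne.symm hv.1)
    · exact hlow u hu v hv.2

theorem sum_le_sum_of_card_le {Y : Type*} (w : Y → ℝ) (hw : ∀ y, 0 ≤ w y)
    {T U : Finset Y} (hTU : T.card ≤ U.card) (hU : ∀ u ∈ U, ∀ t ∉ U, w t ≤ w u) :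
    ∑ y ∈ T, w y ≤ ∑ y ∈ U, w y := by
  rw [← Finset.sum_sdiff_le_sum_sdiff]
  rcases (T \ U).eq_empty_or_nonempty with h | h
  · rw [h, Finset.sum_empty]
    exact Finset.sum_nonneg fun y _ => hw y
  obtain ⟨m, hm, hmax⟩ := Finset.exists_max_image (T \ U) w h
  have hcard : (T \ U).card ≤ (U \ T).card := (Finset.card_sdiff_le_card_sdiff_iff).2 hTU
  calc ∑ y ∈ T \ U, w y ≤ (T \ U).card • w m := Finset.sum_le_card_nsmul _ _ _ hmax
    _ ≤ (U \ T).card • w m := nsmul_le_nsmul_left (hw m) hcard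
    _ ≤ ∑ y ∈ U \ T, w y := Finset.card_nsmul_le_sum _ _ _ fun u hu =>
        hU u (Finset.mem_sdiff.1 hu).1 m (Finset.mem_sdiff.1 hm).2

theorem intervalIntegrable_min_div {x : ℝ} (hx : 0 ≤ x) :
    IntervalIntegrable (fun t => min x t / t) MeasureTheory.volume 0 1 := by
  refine (intervalIntegrable_const (c := (1 : ℝ))).mono_fun
    ((by fun_prop : Measurable fun t : ℝ => min x t / t).aestronglyMeasurable) ?_
  rw [Set.uIoc_of_le zero_le_one]
  refine (MeasureTheory.ae_restrict_iff' measurableSet_Ioc).2 (.of_forall fun t ht => ?_)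
  beta_reduce
  rw [Real.norm_of_nonneg (div_nonneg (le_min hx ht.1.le) ht.1.le), norm_one]
  exact (div_le_one ht.1).2 (min_le_right _ _)

theorem integral_min_div {x : ℝ} (hx : 0 ≤ x) (hx1 : x ≤ 1) :
    ∫ t in (0 : ℝ)..1, min x t / t = x + Real.negMulLog x := by
  rcases hx.eq_or_lt with rfl | hpos
  · rw [intervalIntegral.integral_congr (g := fun _ => (0 : ℝ)) fun t ht => ?_]
    · simp
    · rw [Set.uIcc_of_le zero_le_one] at ht
      simp [min_eq_left ht.1]
  have hint := intervalIntegrable_min_div hx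
  rw [← intervalIntegral.integral_add_adjacent_intervals (b := x)
    (hint.mono_set (Set.uIcc_subset_uIcc_left (Set.mem_uIcc_of_le hx hx1)))
    (hint.mono_set (Set.uIcc_subset_uIcc_right (Set.mem_uIcc_of_le hx hx1)))]
  have h1 : ∫ t in (0 : ℝ)..x, min x t / t = x := by
    rw [intervalIntegral.integral_congr_ae (g := fun _ => (1 : ℝ)) (.of_forall fun t ht => ?_)]
    · simp
    · rw [Set.uIoc_of_le hx] at ht
      rw [min_eq_right ht.2, div_self ht.1.ne']
  have h2 : ∫ t in x..1, min x t / t = Real.negMulLog x := by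
    rw [intervalIntegral.integral_congr (g := fun t => x * t⁻¹) fun t ht => ?_]
    · rw [intervalIntegral.integral_const_mul, integral_inv_of_pos hpos one_pos, one_div,
        Real.log_inv, Real.negMulLog]
      ring
    · rw [Set.uIcc_of_le hx1] at ht
      simp only [min_eq_left ht.1, div_eq_mul_inv]
  rw [h1, h2]

theorem sum_negMulLog_le_of_sum_min_le {X : Type*} [Fintype X] {q r : X → ℝ}
    (hq : ∀ x, 0 ≤ q x) (hr : ∀ x, 0 ≤ r x) (hq1 : ∑ x, q x = 1) (hr1 : ∑ x, r x = 1)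
    (h : ∀ t, 0 < t → ∑ x, min (q x) t ≤ ∑ x, min (r x) t) :
    ∑ x, Real.negMulLog (q x) ≤ ∑ x, Real.negMulLog (r x) := by
  have key : ∀ s : X → ℝ, (∀ x, 0 ≤ s x) → ∑ x, s x = 1 →
      ∫ t in (0 : ℝ)..1, ∑ x, min (s x) t / t = 1 + ∑ x, Real.negMulLog (s x) := by
    intro s hs hs1
    rw [intervalIntegral.integral_finsetSum fun x _ => intervalIntegrable_min_div (hs x)]
    conv_rhs => rw [← hs1, ← Finset.sum_add_distrib]
    refine Finset.sum_congr rfl fun x _ => integral_min_div (hs x) ?_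
    rw [← hs1]
    exact Finset.single_le_sum (fun y _ => hs y) (Finset.mem_univ x)
  have hint : ∀ s : X → ℝ, (∀ x, 0 ≤ s x) →
      IntervalIntegrable (fun t => ∑ x, min (s x) t / t) MeasureTheory.volume 0 1 := by
    intro s hs
    simpa only [Finset.sum_fn] using
      IntervalIntegrable.sum Finset.univ fun x _ => intervalIntegrable_min_div (hs x)
  rw [← add_le_add_iff_left 1, ← key q hq hq1, ← key r hr hr1]
  refine intervalIntegral.integral_mono_on_of_le_Ioo zero_le_one
    (hint q hq) (hint r hr) fun t ht => ?_
  rw [← Finset.sum_div, ← Finset.sum_div]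
  exact div_le_div_of_nonneg_right (h t ht.1) ht.1.le

theorem sum_min_le_of_forall_exists_sum_le {X : Type*} [Fintype X] {q r : X → ℝ}
    (hsum : ∑ x, q x = ∑ x, r x)
    (h : ∀ S : Finset X, ∃ I : Finset X, I.card = S.card ∧ ∑ x ∈ S, r x ≤ ∑ x ∈ I, q x)
    (t : ℝ) : ∑ x, min (q x) t ≤ ∑ x, min (r x) t := by
  obtain ⟨I, hI, hle⟩ := h (Finset.univ.filter fun x => t < r x)
  set S := Finset.univ.filter fun x => t < r x
  have hS : ∑ x, min (r x) t = S.card • t + ∑ x ∈ Sᶜ, r x := by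
    rw [← Finset.sum_add_sum_compl S, ← Finset.sum_const]
    congr 1 <;> refine Finset.sum_congr rfl fun x hx => ?_
    · exact min_eq_right (Finset.mem_filter.1 hx).2.le
    · exact min_eq_left (by simpa [S] using hx)
  have hQ : ∑ x, min (q x) t ≤ I.card • t + ∑ x ∈ Iᶜ, q x := by
    rw [← Finset.sum_add_sum_compl I, ← Finset.sum_const]
    exact add_le_add (Finset.sum_le_sum fun x _ => min_le_right _ _)
      (Finset.sum_le_sum fun x _ => min_le_left _ _)
  have hq := Finset.sum_add_sum_compl I q
  have hr := Finset.sum_add_sum_compl S r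
  rw [hI] at hQ
  linarith

/-- Grouping decreasing weights into consecutive blocks of decreasing sizes minimizes the
entropy of the block sums among all rearrangements of the weights. -/
theorem sum_negMulLog_block_le {X : Type*} [Fintype X] [LinearOrder X] {F : X → Type*}
    [∀ x, Fintype (F x)] (hF : Antitone fun x => Fintype.card (F x))
    (w : (Σ x, F x) → ℝ) (hw0 : ∀ y, 0 ≤ w y) (hw : ∀ y z, y.1 < z.1 → w z ≤ w y)
    (hw1 : ∑ y, w y = 1) (τ : Equiv.Perm (Σ x, F x)) :
    ∑ x, Real.negMulLog (∑ a, w ⟨x, a⟩) ≤ ∑ x, Real.negMulLog (∑ a, w (τ ⟨x, a⟩)) := by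
  have hq1 : ∑ x, ∑ a, w ⟨x, a⟩ = 1 := by rw [← hw1, Fintype.sum_sigma]
  have hr1 : ∑ x, ∑ a, w (τ ⟨x, a⟩) = 1 := by
    rw [← hw1, ← Equiv.sum_comp τ, Fintype.sum_sigma]
  refine sum_negMulLog_le_of_sum_min_le (fun x => Finset.sum_nonneg fun a _ => hw0 _)
    (fun x => Finset.sum_nonneg fun a _ => hw0 _) hq1 hr1
    fun t _ => sum_min_le_of_forall_exists_sum_le (hq1.trans hr1.symm) (fun S => ?_) t
  obtain ⟨I, hI, hlow⟩ := exists_isLowerSet_card_eq (Finset.card_le_univ S)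
  refine ⟨I, hI, ?_⟩
  have hcard : ∑ x ∈ S, Fintype.card (F x) ≤ ∑ x ∈ I, Fintype.card (F x) := by
    have := sum_le_sum_of_card_le (fun x => (Fintype.card (F x) : ℝ)) (fun x => by positivity)
      hI.ge fun u hu t ht => Nat.cast_le.2 (hF (hlow u hu t ht).le)
    exact_mod_cast this
  have hmap := sum_le_sum_of_card_le w hw0
    (T := (S.sigma fun _ => Finset.univ).map τ.toEmbedding) (U := I.sigma fun _ => Finset.univ)
    (by simpa [Finset.card_sigma] using hcard)
    (fun u hu t ht => hw u t (hlow _ (by simpa using hu) _ (by simpa using ht)))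
  simpa [Finset.sum_map, Finset.sum_sigma] using hmap

theorem idx_lt_idx_of_fst_lt (dA dB : Fin K → ℕ) {k k' : Fin K} (hk : k < k')
    (b : Fin (dB k)) (a : Fin (dA k)) (b' : Fin (dB k')) (a' : Fin (dA k')) :
    idx dA dB k b a < idx dA dB k' b' a' := by
  have hoff : offset dA dB k + dA k * dB k ≤ offset dA dB k' := by
    unfold offset
    rw [add_comm, ← Finset.sum_insert (f := fun i => dA i * dB i) (s := Finset.Iio k) (a := k) (by simp)]
    refine Finset.sum_le_sum_of_subset fun i hi => ?_
    rcases Finset.mem_insert.1 hi with rfl | hi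
    · exact Finset.mem_Iio.2 hk
    · exact Finset.mem_Iio.2 ((Finset.mem_Iio.1 hi).trans hk)
  rw [Fin.lt_def]
  simp only [idx]
  have hb : ((b : ℕ) + 1) * dA k ≤ dB k * dA k := Nat.mul_le_mul_right _ b.isLt
  have ha := a.isLt
  rw [add_mul, one_mul, mul_comm (dB k)] at hb
  omega

theorem idx_lt_idx_of_snd_lt (dA dB : Fin K → ℕ) {k : Fin K} {b b' : Fin (dB k)} (hb : b < b')
    (a a' : Fin (dA k)) : idx dA dB k b a < idx dA dB k b' a' := by
  rw [Fin.lt_def]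
  simp only [idx]
  have hb' : ((b : ℕ) + 1) * dA k ≤ b' * dA k := Nat.mul_le_mul_right _ hb
  have ha := a.isLt
  rw [add_mul, one_mul] at hb'
  omega

/-- The position of the `a`-th entry of a block, with the blocks ordered lexicographically. -/
def blockIdx (dA dB : Fin K → ℕ) (y : Σ x : (Σₗ k : Fin K, Fin (dB k)), Fin (dA (ofLex x).1)) :
    Fin (∑ k', dA k' * dB k') :=
  idx dA dB (ofLex y.1).1 (ofLex y.1).2 y.2

theorem blockIdx_lt_blockIdx (dA dB : Fin K → ℕ)
    {y z : Σ x : (Σₗ k : Fin K, Fin (dB k)), Fin (dA (ofLex x).1)} (h : y.1 < z.1) :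
    blockIdx dA dB y < blockIdx dA dB z := by
  obtain ⟨x, a⟩ := y
  obtain ⟨x', a'⟩ := z
  rcases Sigma.Lex.lt_def.1 h with hk | ⟨hk, hb⟩
  · exact idx_lt_idx_of_fst_lt dA dB hk _ _ _ _
  · obtain ⟨k, b⟩ := x
    obtain ⟨k', b'⟩ := x'
    obtain rfl : k = k' := hk
    exact idx_lt_idx_of_snd_lt dA dB hb _ _

theorem blockIdx_injective (dA dB : Fin K → ℕ) : Function.Injective (blockIdx dA dB) := by
  rintro ⟨x, a⟩ ⟨x', a'⟩ h
  rcases lt_trichotomy x x' with hlt | rfl | hlt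
  · exact absurd h (blockIdx_lt_blockIdx dA dB hlt).ne
  · have hval := congrArg Fin.val h
    simp only [blockIdx, idx] at hval
    obtain rfl : a = a' := Fin.ext (by omega)
    rfl
  · exact absurd h (blockIdx_lt_blockIdx dA dB hlt).ne'

theorem sum_lex_sigma (dB : Fin K → ℕ) (f : ∀ k, Fin (dB k) → ℝ) :
    ∑ x : (Σₗ k : Fin K, Fin (dB k)), f (ofLex x).1 (ofLex x).2 = ∑ k, ∑ b, f k b := by
  rw [← Fintype.sum_sigma']
  exact Equiv.sum_comp ofLex fun x : (Σ k : Fin K, Fin (dB k)) => f x.1 x.2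

theorem blockIdx_bijective (dA dB : Fin K → ℕ) : Function.Bijective (blockIdx dA dB) := by
  refine (Fintype.bijective_iff_injective_and_card _).2 ⟨blockIdx_injective dA dB, ?_⟩
  have h := sum_lex_sigma dB fun k _ => (dA k : ℝ)
  rw [Fintype.card_sigma, Fintype.card_fin]
  simp only [Finset.sum_const, Finset.card_univ, Fintype.card_fin, nsmul_eq_mul] at h ⊢
  simp only [mul_comm (dA _)]
  exact_mod_cast h

/-- **Entropy form of the optimal arrangement lemma.** If `p` is nonnegative, decreasingly
sorted, and sums to `1`, then for any permutation `σ`, the Shannon entropy of the family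
`qσ k b = ∑_a p (σ (offset k + b * dA k + a))` is at least that of
`q k b = ∑_a p (offset k + b * dA k + a)`. -/
theorem optimal_arrangement_entropy
    (dA dB : Fin K → ℕ) (hA : ∀ k, 1 ≤ dA k) (hB : ∀ k, 1 ≤ dB k) (hAnti : Antitone dA)
    (p : Fin (∑ k', dA k' * dB k') → ℝ) (hp0 : ∀ i, 0 ≤ p i) (hp : Antitone p)
    (hp1 : ∑ i, p i = 1)
    (σ : Equiv.Perm (Fin (∑ k', dA k' * dB k'))) :
    ∑ k : Fin K, ∑ b : Fin (dB k),
        (- (∑ a : Fin (dA k), p (σ (idx dA dB k b a))) *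
          Real.log (∑ a : Fin (dA k), p (σ (idx dA dB k b a)))) ≥
      ∑ k : Fin K, ∑ b : Fin (dB k),
        (- qval dA dB p k b * Real.log (qval dA dB p k b)) := by
  let e := Equiv.ofBijective (blockIdx dA dB) (blockIdx_bijective dA dB)
  have h := sum_negMulLog_block_le (F := fun x : (Σₗ k : Fin K, Fin (dB k)) => Fin (dA (ofLex x).1))
    (fun x x' hx => by
      simp only [Fintype.card_fin]
      refine hAnti ?_
      rcases Sigma.Lex.le_def.1 hx with hk | ⟨hk, -⟩
      exacts [hk.le, hk.le])
    (fun y => p (e y)) (fun y => hp0 _) (fun y z hyz => hp (blockIdx_lt_blockIdx dA dB hyz).le)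
    (by rw [Equiv.sum_comp e p, hp1]) ((e.trans σ).trans e.symm)
  simp only [Equiv.trans_apply, Equiv.apply_symm_apply] at h
  have hq := sum_lex_sigma dB fun k b => Real.negMulLog (∑ a, p (idx dA dB k b a))
  have hr := sum_lex_sigma dB fun k b => Real.negMulLog (∑ a, p (σ (idx dA dB k b a)))
  exact hq.symm.le.trans (h.trans hr.le)

end AQD
end

section
/- (Block-sum majorization under doubly stochastic mixing, proof part 1 of Theorem 1.) Let dA dB : ℕ with dA ≥ 1 and dB ≥ 1. Let y : Fin (dA · dB) → ℝ be nonnegative and antitone, let B : Matrix (Fin (dA · dB)) (Fin (dA · dB)) ℝ be doubly stochastic (all entries nonnegative, each row sum equal to 1, each column sum equal to 1), and set x := B.mulVec y. Define the block sums Q(v) b := Σ_{a : Fin dA} v (b · dA + a) for b : Fin dB. Then Q(x) is majorized by Q(y): Σ_b Q(x) b = Σ_b Q(y) b, and for every m ≤ dB and every subset s ⊆ Fin dB with card s = m, Σ_{b ∈ s} Q(x) b ≤ Σ_{b < m} Q(y) b. -/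
open scoped Classical Matrix ComplexOrder

namespace AQD

/-- The index `b * dA + a` as an element of `Fin (dA * dB)`. -/
def idx2 (dA dB : ℕ) (b : Fin dB) (a : Fin dA) : Fin (dA * dB) :=
  ⟨(b : ℕ) * dA + (a : ℕ), by
    have ha := a.isLt
    have hb := b.isLt
    calc (b : ℕ) * dA + (a : ℕ) < ((b : ℕ) + 1) * dA := by rw [Nat.add_mul, Nat.one_mul]; omega
      _ ≤ dB * dA := Nat.mul_le_mul_right _ hb
      _ = dA * dB := Nat.mul_comm _ _⟩

/-- Block sums: `Q v b = ∑_{a < dA} v (b * dA + a)`. -/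
def blockSum (dA dB : ℕ) (v : Fin (dA * dB) → ℝ) (b : Fin dB) : ℝ :=
  ∑ a : Fin dA, v (idx2 dA dB b a)

theorem idx2_injective (dA dB : ℕ) :
    Function.Injective (fun p : Fin dB × Fin dA => idx2 dA dB p.1 p.2) := by
  rintro ⟨b, a⟩ ⟨b', a'⟩ h
  have h' : (b : ℕ) * dA + a = b' * dA + a' := congrArg Fin.val h
  have hpos : 0 < dA := a.pos
  have hb : (b : ℕ) = b' := by
    have := congrArg (· / dA) h'
    simpa [mul_comm _ dA, Nat.mul_add_div hpos, Nat.div_eq_of_lt] using this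
  have ha : (a : ℕ) = a' := by
    rw [hb] at h'
    omega
  exact Prod.ext (Fin.ext hb) (Fin.ext ha)

/-- The indices lying in the blocks labelled by `s`. -/
def blockIndices (dA dB : ℕ) (s : Finset (Fin dB)) : Finset (Fin (dA * dB)) :=
  (s ×ˢ Finset.univ).map ⟨_, idx2_injective dA dB⟩

theorem card_blockIndices (dA dB : ℕ) (s : Finset (Fin dB)) :
    (blockIndices dA dB s).card = s.card * dA := by
  simp [blockIndices]

theorem sum_blockSum (dA dB : ℕ) (v : Fin (dA * dB) → ℝ) (s : Finset (Fin dB)) :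
    ∑ b ∈ s, blockSum dA dB v b = ∑ i ∈ blockIndices dA dB s, v i := by
  simp [blockIndices, blockSum, Finset.sum_product]

theorem blockIndices_univ (dA dB : ℕ) : blockIndices dA dB Finset.univ = Finset.univ := by
  rw [← Finset.card_eq_iff_eq_univ, card_blockIndices]
  simp [mul_comm]

theorem mem_blockIndices_filter_lt (dA dB m : ℕ) (j : Fin (dA * dB)) :
    j ∈ blockIndices dA dB (Finset.univ.filter (fun b : Fin dB => (b : ℕ) < m)) ↔
      (j : ℕ) < m * dA := by
  have hj : j ∈ blockIndices dA dB Finset.univ := by simp [blockIndices_univ]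
  obtain ⟨⟨b, a⟩, -, rfl⟩ := Finset.mem_map.mp hj
  rw [blockIndices, Finset.mem_map']
  have ha := a.isLt
  simp only [Finset.mem_product, Finset.mem_filter, Finset.mem_univ, true_and, and_true,
    Function.Embedding.coeFn_mk, idx2]
  constructor
  · intro h
    have := Nat.mul_le_mul_right dA (Nat.succ_le_of_lt h)
    rw [Nat.succ_mul] at this
    omega
  · intro h
    exact lt_of_mul_lt_mul_right (lt_of_le_of_lt (Nat.le_add_right _ _) h) (Nat.zero_le dA)

/-- Weights in `[0, 1]` of total mass `T.card` give at most the sum over `T`, when `T` consists of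
the indices of largest values. -/
theorem sum_mul_le_sum_of_threshold {ι : Type*} [Fintype ι] (w y : ι → ℝ) (T : Finset ι) (c : ℝ)
    (hw0 : ∀ j, 0 ≤ w j) (hw1 : ∀ j, w j ≤ 1) (hw : ∑ j, w j = T.card)
    (hT : ∀ j ∈ T, c ≤ y j) (hT' : ∀ j ∉ T, y j ≤ c) :
    ∑ j, w j * y j ≤ ∑ j ∈ T, y j := by
  have key : ∑ j, w j * (y j - c) ≤ ∑ j, if j ∈ T then y j - c else 0 := by
    refine Finset.sum_le_sum fun j _ => ?_
    split_ifs with h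
    · exact mul_le_of_le_one_left (sub_nonneg.2 (hT j h)) (hw1 j)
    · exact mul_nonpos_of_nonneg_of_nonpos (hw0 j) (sub_nonpos.2 (hT' j h))
  rw [Finset.sum_ite_mem, Finset.univ_inter] at key
  simp only [mul_sub, Finset.sum_sub_distrib, ← Finset.sum_mul, hw, Finset.sum_const,
    nsmul_eq_mul] at key
  linarith

theorem sum_mulVec {ι : Type*} [Fintype ι] (B : Matrix ι ι ℝ) (y : ι → ℝ) (S : Finset ι) :
    ∑ i ∈ S, B.mulVec y i = ∑ j, (∑ i ∈ S, B i j) * y j := by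
  simp only [Matrix.mulVec, dotProduct, Finset.sum_mul]
  exact Finset.sum_comm

/-- **Block-sum majorization under doubly stochastic mixing.** Let `y` be nonnegative and
decreasingly sorted, `B` doubly stochastic, and `x = B y`. Then the block sums `Q(x)` are
majorized by the block sums `Q(y)`: the totals agree and, for every `m ≤ dB`, the sum of any
`m` entries of `Q(x)` is at most the sum of the first (largest) `m` entries of `Q(y)`. -/
theorem blockSum_majorized_of_doublyStochastic (dA dB : ℕ) (hA : 1 ≤ dA) (hB : 1 ≤ dB)
    (y : Fin (dA * dB) → ℝ) (hy0 : ∀ i, 0 ≤ y i) (hy : Antitone y)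
    (B : Matrix (Fin (dA * dB)) (Fin (dA * dB)) ℝ)
    (hB0 : ∀ i j, 0 ≤ B i j) (hrow : ∀ i, ∑ j, B i j = 1) (hcol : ∀ j, ∑ i, B i j = 1) :
    (∑ b : Fin dB, blockSum dA dB (B.mulVec y) b = ∑ b : Fin dB, blockSum dA dB y b) ∧
      ∀ m ≤ dB, ∀ s : Finset (Fin dB), s.card = m →
        ∑ b ∈ s, blockSum dA dB (B.mulVec y) b ≤
          ∑ b ∈ Finset.univ.filter (fun b : Fin dB => (b : ℕ) < m), blockSum dA dB y b := by
  constructor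
  · simp [sum_blockSum, blockIndices_univ, sum_mulVec, hcol]
  · intro m hm s hs
    rw [sum_blockSum, sum_blockSum, sum_mulVec]
    refine sum_mul_le_sum_of_threshold _ y _
      (if h : m * dA < dA * dB then y ⟨m * dA, h⟩ else 0)
      (fun j => Finset.sum_nonneg fun i _ => hB0 i j) (fun j => ?_) ?_ ?_ ?_
    · rw [← hcol j]
      exact Finset.sum_le_sum_of_subset_of_nonneg (Finset.subset_univ _) fun i _ _ => hB0 i j
    · rw [Finset.sum_comm]
      simp [hrow, card_blockIndices, hs, Fin.card_filter_val_lt, hm]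
    · intro j hj
      rw [mem_blockIndices_filter_lt] at hj
      split_ifs with h
      · exact hy (Fin.mk_le_mk.2 hj.le)
      · exact hy0 j
    · intro j hj
      rw [mem_blockIndices_filter_lt, not_lt] at hj
      rw [dif_pos (hj.trans_lt j.isLt)]
      exact hy (Fin.mk_le_mk.2 hj)

end AQD
end
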